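/- Let D be a weighted oriented graph having at most two unbalanced cycles such that (i) if D has exactly two unbalanced cycles connected by a path P, then no balanced cycle in D shares an edge with P, and (ii) no two balanced cycles in D share a path. Then the Graver basis equals the set of circuits, Gr_D = C_D, and moreover I_D is strongly robust, i.e., Gr_D is a minimal generating set of I_D. -/

import Mathlib

open MvPolynomial Finset

/-- The "positive part" `∏ e, X e ^ (b e)⁺` of the binomial associated to an
integer vector `b`. -/
noncomputable def binomPlus (K : Type*) [Field K] {ι : Type*} [Fintype ι]
    (b : ι → ℤ) : MvPolynomial ι K :=
  ∏ e, X e ^ (b e).toNat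

/-- The "negative part" `∏ e, X e ^ (b e)⁻` of the binomial associated to an
integer vector `b`. -/
noncomputable def binomMinus (K : Type*) [Field K] {ι : Type*} [Fintype ι]
    (b : ι → ℤ) : MvPolynomial ι K :=
  ∏ e, X e ^ (-b e).toNat

/-- The (pure) binomial `f_b = f_b⁺ - f_b⁻` associated to an integer vector `b`. -/
noncomputable def binom (K : Type*) [Field K] {ι : Type*} [Fintype ι]
    (b : ι → ℤ) : MvPolynomial ι K :=
  binomPlus K b - binomMinus K b

/-- Support of an integer vector. -/
def vsupp {ι : Type*} (b : ι → ℤ) : Set ι := {e | b e ≠ 0}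

/-- `f_b` is a primitive binomial of the ideal `I`. -/
def IsPrimitiveIn (K : Type*) [Field K] {ι : Type*} [Fintype ι]
    (I : Ideal (MvPolynomial ι K)) (b : ι → ℤ) : Prop :=
  b ≠ 0 ∧ binom K b ∈ I ∧
    ∀ c : ι → ℤ, c ≠ 0 → binom K c ∈ I →
      binomPlus K c ∣ binomPlus K b → binomMinus K c ∣ binomMinus K b → c = b

/-- A (vertex-)weighted oriented graph: finite sets of vertices and edges, each
edge `e` oriented from `src e` to `tgt e`, no loops, no parallel edges, and a
positive integer weight attached to every vertex. -/
structure WOGraph (V E : Type*) where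
  src : E → V
  tgt : E → V
  w : V → ℕ
  no_loop : ∀ e, src e ≠ tgt e
  no_parallel : ∀ e e' : E, s(src e, tgt e) = s(src e', tgt e') → e = e'
  wpos : ∀ v, 0 < w v

namespace WOGraph

variable {V E : Type*}

/-- The toric ideal `I_D` of a weighted oriented graph: the kernel of
`K[e : e ∈ E(D)] → K[x : x ∈ V(D)]`, `e = (x_i,x_j) ↦ x_i x_j ^ w_j`. -/
noncomputable def toricIdeal (D : WOGraph V E) (K : Type*) [Field K] :
    Ideal (MvPolynomial E K) :=
  RingHom.ker (aeval (R := K)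
    (fun e => X (D.src e) * X (D.tgt e) ^ D.w (D.tgt e)) :
      MvPolynomial E K →ₐ[K] MvPolynomial V K).toRingHom

/-- The edge `e` is incident with the vertex `v`. -/
def incident (D : WOGraph V E) (v : V) (e : E) : Prop :=
  D.src e = v ∨ D.tgt e = v

/-- Degree of a vertex. -/
noncomputable def degree (D : WOGraph V E) (v : V) : ℕ :=
  Set.ncard {e : E | D.incident v e}

/-- A leaf is a vertex of degree 1. -/
def IsLeaf (D : WOGraph V E) (v : V) : Prop := D.degree v = 1

/-- A sink is a vertex of outdegree 0. -/
def IsSink (D : WOGraph V E) (v : V) : Prop := ∀ e, D.src e ≠ v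

/-- The Graver basis `Gr_D`: the set of primitive binomials of `I_D`. -/
def graverSet (D : WOGraph V E) (K : Type*) [Field K] [Fintype E] :
    Set (MvPolynomial E K) :=
  {f | ∃ b : E → ℤ, f = binom K b ∧ IsPrimitiveIn K (D.toricIdeal K) b}

/-- The set `C_D` of circuits of `I_D`: irreducible binomials of `I_D` with
minimal support. -/
def circuitSet (D : WOGraph V E) (K : Type*) [Field K] [Fintype E] :
    Set (MvPolynomial E K) :=
  {f | ∃ b : E → ℤ, f = binom K b ∧ b ≠ 0 ∧ binom K b ∈ D.toricIdeal K ∧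
      (Finset.univ.gcd fun e => (b e).natAbs) = 1 ∧
      ∀ c : E → ℤ, c ≠ 0 → binom K c ∈ D.toricIdeal K →
        vsupp c ⊆ vsupp b → vsupp c = vsupp b}

/-- Cyclic successor on `Fin n`. -/
def finRot {n : ℕ} (i : Fin n) : Fin n := ⟨((i : ℕ) + 1) % n, Nat.mod_lt _ i.pos⟩

/-- A cycle of length `n ≥ 3` in a weighted oriented graph `D`, with its usual
labelling: the edge `edge i` joins the vertices `vert i` and `vert (i+1)`
(indices cyclically). -/
structure CycleIn (D : WOGraph V E) where
  n : ℕ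
  hn : 3 ≤ n
  vert : Fin n → V
  edge : Fin n → E
  vinj : Function.Injective vert
  einj : Function.Injective edge
  hinc : ∀ i : Fin n, s(D.src (edge i), D.tgt (edge i)) = s(vert i, vert (finRot i))

/-- A path of length `k ≥ 1` in `D`, with its usual labelling: the edge `edge i`
joins `vert i` and `vert (i+1)`. -/
structure PathIn (D : WOGraph V E) where
  k : ℕ
  hk : 1 ≤ k
  vert : Fin (k + 1) → V
  edge : Fin k → E
  vinj : Function.Injective vert
  einj : Function.Injective edge
  hinc : ∀ i : Fin k, s(D.src (edge i), D.tgt (edge i)) = s(vert i.castSucc, vert i.succ)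

variable [DecidableEq V]

/-- The incidence entry of a vertex `v` and an edge `e`: `1` if `e` leaves `v`,
`w v` if `e` enters `v`, `0` otherwise. -/
def inc (D : WOGraph V E) (v : V) (e : E) : ℤ :=
  if D.src e = v then 1 else if D.tgt e = v then (D.w v : ℤ) else 0

/-- The incidence matrix of a cycle in `D` (with respect to its usual labelling). -/
def CycleIn.mat {D : WOGraph V E} (C : CycleIn D) : Matrix (Fin C.n) (Fin C.n) ℤ :=
  fun i j => D.inc (C.vert i) (C.edge j)

/-- A cycle is balanced if its incidence matrix is singular. -/
def CycleIn.IsBalanced {D : WOGraph V E} (C : CycleIn D) : Prop := C.mat.det = 0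

/-- A cycle is unbalanced if its incidence matrix is nonsingular. -/
def CycleIn.IsUnbalanced {D : WOGraph V E} (C : CycleIn D) : Prop := C.mat.det ≠ 0

end WOGraph

namespace WOGraph

variable {V E : Type*}

/-- Two cycles share exactly one vertex. -/
def ShareOneVertex {D : WOGraph V E} (C₁ C₂ : CycleIn D) : Prop :=
  (∃ v : V, Set.range C₁.vert ∩ Set.range C₂.vert = {v}) ∧
    Set.range C₁.edge ∩ Set.range C₂.edge = ∅

/-- Two cycles share the path `P`. -/
def SharePath {D : WOGraph V E} (C₁ C₂ : CycleIn D) (P : PathIn D) : Prop :=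
  Set.range P.edge ⊆ Set.range C₁.edge ∧ Set.range P.edge ⊆ Set.range C₂.edge ∧
    Set.range C₁.edge ∩ Set.range C₂.edge = Set.range P.edge ∧
    Set.range C₁.vert ∩ Set.range C₂.vert = Set.range P.vert

/-- Two (disjoint) cycles are connected by the path `P`, which meets `C₁` only in
its first vertex and `C₂` only in its last vertex. -/
def ConnectedByPath {D : WOGraph V E} (C₁ C₂ : CycleIn D) (P : PathIn D) : Prop :=
  Set.range C₁.vert ∩ Set.range C₂.vert = ∅ ∧
    P.vert 0 ∈ Set.range C₁.vert ∧ P.vert (Fin.last P.k) ∈ Set.range C₂.vert ∧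
    (∀ i : Fin (P.k + 1), i ≠ 0 → P.vert i ∉ Set.range C₁.vert) ∧
    (∀ i : Fin (P.k + 1), i ≠ Fin.last P.k → P.vert i ∉ Set.range C₂.vert) ∧
    Set.range P.edge ∩ (Set.range C₁.edge ∪ Set.range C₂.edge) = ∅

/-- `f` is the primitive binomial generator of the (principal) toric ideal of the
subgraph of `D` with edge set `S` (identified with the binomials of `I_D`
supported in `S`). -/
def IsPrimGenOn (D : WOGraph V E) (K : Type*) [Field K] [Fintype E]
    (S : Set E) (f : MvPolynomial E K) : Prop :=
  ∃ b : E → ℤ, f = binom K b ∧ b ≠ 0 ∧ vsupp b ⊆ S ∧ binom K b ∈ D.toricIdeal K ∧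
    (∀ c : E → ℤ, c ≠ 0 → vsupp c ⊆ S → binom K c ∈ D.toricIdeal K →
      binomPlus K c ∣ binomPlus K b → binomMinus K c ∣ binomMinus K b → c = b) ∧
    (∀ g : MvPolynomial E K, g ∈ D.toricIdeal K →
      (∀ m ∈ g.support, ∀ e : E, m e ≠ 0 → e ∈ S) → g ∈ Ideal.span {f})

end WOGraph

section LatticeBinomials

variable {ι : Type*}

/-- The vector `b` lies in `L` and its support is minimal among supports of nonzero
vectors of `L`. -/
def IsMinSupp (L : Submodule ℤ (ι → ℤ)) (b : ι → ℤ) : Prop :=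
  b ∈ L ∧ b ≠ 0 ∧ ∀ c ∈ L, c ≠ 0 → vsupp c ⊆ vsupp b → vsupp c = vsupp b

/-- The positive and negative parts of `c` are bounded by those of `b`. -/
def SignLE (c b : ι → ℤ) : Prop :=
  ∀ e, (c e).toNat ≤ (b e).toNat ∧ (-c e).toNat ≤ (-b e).toNat

lemma SignLE.vsupp_subset {c b : ι → ℤ} (h : SignLE c b) : vsupp c ⊆ vsupp b := by
  intro e he hb
  have := h e
  simp only [vsupp, Set.mem_ofPred_eq] at he
  omega

lemma vsupp_nonempty {b : ι → ℤ} (hb : b ≠ 0) : ∃ e, e ∈ vsupp b := by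
  by_contra! h
  exact hb (funext fun e => by simpa [vsupp] using h e)

/-- Two vectors of `L`, combined so that the coordinate `e` cancels. -/
lemma cross_mem {L : Submodule ℤ (ι → ℤ)} {b c : ι → ℤ} (hb : b ∈ L) (hc : c ∈ L) (e : ι) :
    (fun f => c e * b f - b e * c f) ∈ L :=
  L.sub_mem (L.smul_mem (c e) hb) (L.smul_mem (b e) hc)

lemma exists_isMinSupp_mem [Finite ι] {L : Submodule ℤ (ι → ℤ)} {b : ι → ℤ} (hb : b ∈ L)
    {f : ι} (hf : f ∈ vsupp b) : ∃ c, IsMinSupp L c ∧ f ∈ vsupp c ∧ vsupp c ⊆ vsupp b := by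
  classical
  have hex : ∃ n, ∃ c ∈ L, f ∈ vsupp c ∧ vsupp c ⊆ vsupp b ∧ (vsupp c).ncard = n :=
    ⟨_, b, hb, hf, subset_rfl, rfl⟩
  obtain ⟨c, hcL, hfc, hcb, hcard⟩ := Nat.find_spec hex
  refine ⟨c, ⟨hcL, fun h => hfc (by simp [h]), fun h hL h0 hsub => ?_⟩, hfc, hcb⟩
  by_contra hne
  have hss : vsupp h ⊂ vsupp c := hsub.ssubset_of_ne hne
  by_cases hfh : f ∈ vsupp h
  · exact Nat.find_min hex (hcard ▸ Set.ncard_lt_ncard hss (Set.toFinite _))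
      ⟨h, hL, hfh, hsub.trans hcb, rfl⟩
  · obtain ⟨g, hg⟩ := vsupp_nonempty h0
    have hfh0 : h f = 0 := by simpa [vsupp] using hfh
    have hsub' : vsupp (fun x => h g * c x - c g * h x) ⊆ vsupp c := by
      intro x hx hx0
      have : h x = 0 := by
        by_contra hh
        exact hsub (show x ∈ vsupp h from hh) hx0
      simp [vsupp, this, hx0] at hx
    have hss' : vsupp (fun x => h g * c x - c g * h x) ⊂ vsupp c := by
      refine hsub'.ssubset_of_ne fun heq => ?_
      have : g ∈ vsupp (fun x => h g * c x - c g * h x) := heq ▸ hsub hg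
      exact this (by ring)
    refine Nat.find_min hex (hcard ▸ Set.ncard_lt_ncard hss' (Set.toFinite _))
      ⟨_, cross_mem hcL hL g, ?_, hsub'.trans hcb, rfl⟩
    simpa [vsupp, hfh0] using ⟨hg, hfc⟩

variable [Fintype ι]

lemma exists_eq_mul_of_gcd_eq_one {c b : ι → ℤ}
    (hc : (Finset.univ.gcd fun e => (c e).natAbs) = 1) {e : ι} (he : c e ≠ 0)
    (h : ∀ f, c f ≠ 0 → c e * b f = b e * c f) : ∃ k : ℤ, ∀ f, c f ≠ 0 → b f = k * c f := by
  have hdvd : c e ∣ b e := by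
    rw [← Int.natAbs_dvd_natAbs]
    have : (c e).natAbs ∣ Finset.univ.gcd fun f => (b e).natAbs * (c f).natAbs := by
      refine Finset.dvd_gcd fun f _ => ?_
      rw [← Int.natAbs_mul, Int.natAbs_dvd_natAbs]
      by_cases hf : c f = 0
      · simp [hf]
      · exact ⟨b f, (h f hf).symm⟩
    rw [Finset.gcd_mul_left, hc] at this
    simpa using this
  obtain ⟨k, hk⟩ := hdvd
  refine ⟨k, fun f hf => mul_left_cancel₀ he ?_⟩
  rw [h f hf, hk]
  ring

lemma exists_isMinSupp_gcd_eq_one {L : Submodule ℤ (ι → ℤ)}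
    (hsat : ∀ (n : ℤ) (b : ι → ℤ), n ≠ 0 → n • b ∈ L → b ∈ L) {b : ι → ℤ}
    (hb : IsMinSupp L b) : ∃ c, IsMinSupp L c ∧ vsupp c = vsupp b ∧
      (Finset.univ.gcd fun e => (c e).natAbs) = 1 := by
  obtain ⟨e, he⟩ := vsupp_nonempty hb.2.1
  obtain ⟨c, hbc, hgcd⟩ := Finset.extract_gcd b (s := Finset.univ) ⟨e, Finset.mem_univ e⟩
  set g := Finset.univ.gcd b
  have hg : g ≠ 0 := fun h => he (by rw [hbc e (Finset.mem_univ e), h, zero_mul])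
  have hs : vsupp c = vsupp b := by
    ext x
    simp [vsupp, hbc x (Finset.mem_univ x), hg]
  have hbg : b = g • c := funext fun x => by simpa using hbc x (Finset.mem_univ x)
  refine ⟨c, ⟨hsat g c hg (hbg ▸ hb.1), ?_, ?_⟩, hs, ?_⟩
  · rintro rfl
    exact hb.2.1 (by simp [hbg])
  · rw [hs]
    exact hb.2.2
  · have : ((Finset.univ.gcd fun e => (c e).natAbs : ℕ) : ℤ) ∣ Finset.univ.gcd c := by
      refine Finset.dvd_gcd fun f hf => ?_
      rw [Int.natCast_dvd]
      exact Finset.gcd_dvd hf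
    rw [hgcd] at this
    exact Nat.dvd_one.mp (by exact_mod_cast this)

/-- If distinct minimal supports are disjoint, then every vector of `L` restricts to an
integer multiple of a given primitive minimal support vector. -/
lemma IsMinSupp.exists_restrict_eq_mul {L : Submodule ℤ (ι → ℤ)}
    (hdisj : ∀ b c, IsMinSupp L b → IsMinSupp L c → ∀ e ∈ vsupp b, e ∈ vsupp c →
      vsupp b = vsupp c) {b c : ι → ℤ} (hb : b ∈ L) (hc : IsMinSupp L c)
    (hgcd : (Finset.univ.gcd fun e => (c e).natAbs) = 1) :
    ∃ k : ℤ, ∀ f, c f ≠ 0 → b f = k * c f := by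
  obtain ⟨e, he⟩ := vsupp_nonempty hc.2.1
  refine exists_eq_mul_of_gcd_eq_one hgcd he fun f hf => ?_
  by_contra hne
  obtain ⟨d, hd, hfd, hdsub⟩ := exists_isMinSupp_mem (cross_mem hb hc.1 e)
    (show f ∈ vsupp (fun f => c e * b f - b e * c f) from sub_ne_zero.mpr hne)
  have heq := hdisj d c hd hc f hfd hf
  exact hdsub (heq ▸ he) (by ring)

lemma exists_conformal_primitive {L : Submodule ℤ (ι → ℤ)} {b : ι → ℤ} (hb : b ∈ L)
    (h0 : b ≠ 0) : ∃ c ∈ L, c ≠ 0 ∧ SignLE c b ∧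
      ∀ d ∈ L, d ≠ 0 → SignLE d c → d = c := by
  classical
  have hex : ∃ n, ∃ c ∈ L, c ≠ 0 ∧ SignLE c b ∧ ∑ e, (c e).natAbs = n :=
    ⟨_, b, hb, h0, fun e => ⟨le_rfl, le_rfl⟩, rfl⟩
  obtain ⟨c, hcL, hc0, hcb, hcard⟩ := Nat.find_spec hex
  refine ⟨c, hcL, hc0, hcb, fun d hd hd0 hdc => ?_⟩
  by_contra hne
  have hex' : ∃ e, d e ≠ c e := by
    by_contra! h
    exact hne (funext h)
  obtain ⟨e, he⟩ := hex'
  have hlt : ∑ e, (d e).natAbs < ∑ e, (c e).natAbs := by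
    refine Finset.sum_lt_sum (fun x _ => ?_) ⟨e, Finset.mem_univ e, ?_⟩
    · have := hdc x
      omega
    · have := hdc e
      omega
  exact Nat.find_min hex (hcard ▸ hlt)
    ⟨d, hd, hd0, fun x => ⟨(hdc x).1.trans (hcb x).1, (hdc x).2.trans (hcb x).2⟩, rfl⟩

variable (K : Type*) [Field K]

lemma prod_X_pow_eq_monomial' (n : ι → ℕ) :
    (∏ e, X e ^ n e : MvPolynomial ι K) = monomial (Finsupp.equivFunOnFinite.symm n) 1 := by
  rw [monomial_eq, Finsupp.prod_fintype _ _ (by simp)]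
  simp

lemma binomPlus_dvd_and_iff {c b : ι → ℤ} :
    (binomPlus K c ∣ binomPlus K b ∧ binomMinus K c ∣ binomMinus K b) ↔ SignLE c b := by
  simp only [binomPlus, binomMinus, prod_X_pow_eq_monomial', monomial_dvd_monomial,
    one_ne_zero, false_or, dvd_refl, and_true, SignLE, Finsupp.le_def, forall_and,
    Finsupp.equivFunOnFinite_symm_apply_apply]

lemma binom_neg (b : ι → ℤ) : binom K (-b) = -binom K b := by
  simp [binom, binomPlus, binomMinus]

lemma binom_ne_zero {b : ι → ℤ} (hb : b ≠ 0) : binom K b ≠ 0 := by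
  obtain ⟨e, he⟩ := vsupp_nonempty hb
  simp only [binom, binomPlus, binomMinus, prod_X_pow_eq_monomial', sub_ne_zero]
  intro h
  have := DFunLike.congr_fun (monomial_left_injective one_ne_zero h) e
  simp only [Finsupp.equivFunOnFinite_symm_apply_apply] at this
  simp only [vsupp, Set.mem_ofPred_eq] at he
  omega

/-- Splitting off a conformal summand expresses a binomial through smaller ones. -/
lemma binom_eq_add_of_conformal {c b : ι → ℤ} (h : SignLE c b) :
    binom K b = binomPlus K (b - c) * binom K c + binomMinus K c * binom K (b - c) := by
  have h1 : binomPlus K b = binomPlus K (b - c) * binomPlus K c := by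
    simp only [binomPlus, ← Finset.prod_mul_distrib, ← pow_add]
    refine Finset.prod_congr rfl fun e _ => ?_
    have := h e
    congr 1
    simp only [Pi.sub_apply]
    omega
  have h2 : binomMinus K b = binomMinus K (b - c) * binomMinus K c := by
    simp only [binomMinus, ← Finset.prod_mul_distrib, ← pow_add]
    refine Finset.prod_congr rfl fun e _ => ?_
    have := h e
    congr 1
    simp only [Pi.sub_apply]
    omega
  rw [binom, h1, h2, binom, binom]
  ring

lemma binom_mem_span_of_primitive {L : Submodule ℤ (ι → ℤ)} {b : ι → ℤ} (hb : b ∈ L) :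
    binom K b ∈ Ideal.span {f | ∃ c ∈ L, c ≠ 0 ∧
      (∀ d ∈ L, d ≠ 0 → SignLE d c → d = c) ∧ f = binom K c} := by
  induction hn : ∑ e, (b e).natAbs using Nat.strong_induction_on generalizing b with
  | _ n ih =>
    by_cases h0 : b = 0
    · simp [h0, binom, binomPlus, binomMinus]
    obtain ⟨c, hc, hc0, hcb, hprim⟩ := exists_conformal_primitive hb h0
    rw [binom_eq_add_of_conformal K hcb]
    refine Ideal.add_mem _ (Ideal.mul_mem_left _ _ (Ideal.subset_span ⟨c, hc, hc0, hprim, rfl⟩))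
      (Ideal.mul_mem_left _ _ (ih _ ?_ (L.sub_mem hb hc) rfl))
    obtain ⟨e, he⟩ := vsupp_nonempty hc0
    rw [← hn]
    refine Finset.sum_lt_sum (fun x _ => ?_) ⟨e, Finset.mem_univ e, ?_⟩
    · have := hcb x
      simp only [Pi.sub_apply]
      omega
    · have := hcb e
      simp only [vsupp, Set.mem_ofPred_eq] at he
      simp only [Pi.sub_apply]
      omega

/-- A binomial is not in the ideal generated by binomials with support disjoint from its own. -/
lemma binom_notMem_span_of_disjoint {b : ι → ℤ} (hb : b ≠ 0) {G : Set (MvPolynomial ι K)}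
    (hG : ∀ g ∈ G, ∃ c, g = binom K c ∧ Disjoint (vsupp c) (vsupp b)) :
    binom K b ∉ Ideal.span G := by
  classical
  let ψ : MvPolynomial ι K →ₐ[K] MvPolynomial ι K :=
    aeval fun e => if e ∈ vsupp b then X e else 1
  have hker : Ideal.span G ≤ RingHom.ker ψ := by
    refine Ideal.span_le.mpr fun g hg => ?_
    obtain ⟨c, rfl, hcb⟩ := hG g hg
    have key : ∀ e, (c e ≠ 0 → e ∉ vsupp b) := fun e he h => Set.disjoint_left.mp hcb he h
    simp only [SetLike.mem_coe, RingHom.mem_ker, binom, binomPlus, binomMinus, map_sub, map_prod,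
      map_pow, ψ, aeval_X]
    rw [Finset.prod_eq_one, Finset.prod_eq_one, sub_self]
    all_goals
      intro e _
      by_cases he : c e = 0
      · simp [he]
      · simp [key e he]
  intro hmem
  have h0 : ψ (binom K b) = 0 := hker hmem
  refine binom_ne_zero K hb ?_
  rw [← h0]
  simp only [binom, binomPlus, binomMinus, map_sub, map_prod, map_pow, ψ, aeval_X]
  congr 1
  all_goals
    refine Finset.prod_congr rfl fun e _ => ?_
    by_cases he : b e = 0
    · simp [he]
    · simp [vsupp, he]

end LatticeBinomials

namespace WOGraph

section ToricIdeal

variable {V E : Type*} (D : WOGraph V E)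

/-- The exponent vector of the monomial attached to an edge. -/
noncomputable def edgeExp (e : E) : V →₀ ℕ :=
  Finsupp.single (D.src e) 1 + Finsupp.single (D.tgt e) (D.w (D.tgt e))

lemma inc_eq_edgeExp [DecidableEq V] (v : V) (e : E) : D.inc v e = (D.edgeExp e v : ℤ) := by
  have h := D.no_loop e
  simp only [inc, edgeExp, Finsupp.add_apply, Finsupp.single_apply]
  by_cases h1 : D.src e = v
  · have h2 : D.tgt e ≠ v := fun h' => h (h1.trans h'.symm)
    simp [h1, h2]
  · by_cases h2 : D.tgt e = v
    · simp [h1, h2]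
    · simp [h1, h2]

variable [Fintype E]

lemma aeval_monomial_eq (K : Type*) [Field K] (m : E →₀ ℕ) (a : K) :
    aeval (R := K) (fun e => X (D.src e) * X (D.tgt e) ^ D.w (D.tgt e) :
      E → MvPolynomial V K) (monomial m a) = monomial (∑ e, m e • D.edgeExp e) a := by
  have h : ∀ e, (X (D.src e) * X (D.tgt e) ^ D.w (D.tgt e) : MvPolynomial V K) =
      monomial (D.edgeExp e) 1 := by
    intro e
    rw [edgeExp, X_pow_eq_monomial, X, monomial_mul, one_mul]
  rw [aeval_monomial, Finsupp.prod_fintype _ _ (by simp)]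
  simp only [h, monomial_pow, one_pow]
  rw [← monomial_sum_one, algebraMap_eq, C_mul_monomial, mul_one]

/-- The integer kernel of the incidence matrix of `D`. -/
def lattice [DecidableEq V] : Submodule ℤ (E → ℤ) where
  carrier := {b | ∀ v, ∑ e, D.inc v e * b e = 0}
  add_mem' {a b} ha hb v := by
    simp [mul_add, Finset.sum_add_distrib, ha v, hb v]
  zero_mem' v := by simp
  smul_mem' n b hb v := by
    have := congrArg (n * ·) (hb v)
    simp only [Finset.mul_sum, mul_zero] at this
    rw [← this]
    refine Finset.sum_congr rfl fun e _ => ?_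
    simp only [Pi.smul_apply, smul_eq_mul]
    ring

variable [DecidableEq V]

lemma mem_lattice {b : E → ℤ} : b ∈ D.lattice ↔ ∀ v, ∑ e, D.inc v e * b e = 0 := Iff.rfl

lemma mem_lattice_of_smul (n : ℤ) (b : E → ℤ) (hn : n ≠ 0) (h : n • b ∈ D.lattice) :
    b ∈ D.lattice := by
  intro v
  refine mul_left_cancel₀ hn ?_
  rw [mul_zero, ← h v, Finset.mul_sum]
  refine Finset.sum_congr rfl fun e _ => ?_
  simp only [Pi.smul_apply, smul_eq_mul]
  ring

variable (K : Type*) [Field K]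

lemma sum_edgeExp_eq_iff (m m' : E →₀ ℕ) :
    ∑ e, m e • D.edgeExp e = ∑ e, m' e • D.edgeExp e ↔
      (fun e => (m e : ℤ) - m' e) ∈ D.lattice := by
  rw [mem_lattice, Finsupp.ext_iff]
  refine forall_congr' fun v => ?_
  simp only [Finsupp.finsetSum_apply, Finsupp.smul_apply, smul_eq_mul, inc_eq_edgeExp, mul_sub,
    Finset.sum_sub_distrib, sub_eq_zero]
  rw [← Nat.cast_inj (R := ℤ)]
  push_cast
  simp only [mul_comm]

lemma monomial_sub_mem_toricIdeal (m m' : E →₀ ℕ) :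
    (monomial m 1 - monomial m' 1 : MvPolynomial E K) ∈ D.toricIdeal K ↔
      (fun e => (m e : ℤ) - m' e) ∈ D.lattice := by
  rw [← sum_edgeExp_eq_iff, toricIdeal, RingHom.mem_ker]
  change aeval _ _ = 0 ↔ _
  rw [map_sub, aeval_monomial_eq, aeval_monomial_eq, sub_eq_zero]
  exact (monomial_left_injective one_ne_zero).eq_iff

lemma binom_mem_toricIdeal {b : E → ℤ} : binom K b ∈ D.toricIdeal K ↔ b ∈ D.lattice := by
  rw [binom, binomPlus, binomMinus, prod_X_pow_eq_monomial', prod_X_pow_eq_monomial',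
    monomial_sub_mem_toricIdeal]
  have : (fun e => (((Finsupp.equivFunOnFinite.symm fun e => (b e).toNat) e : ℕ) : ℤ) -
      ((Finsupp.equivFunOnFinite.symm fun e => (-b e).toNat) e : ℕ)) = b := by
    funext e
    simp only [Finsupp.equivFunOnFinite_symm_apply_apply]
    omega
  rw [this]

lemma monomial_sub_mem_span {m m' : E →₀ ℕ}
    (h : ∑ e, m e • D.edgeExp e = ∑ e, m' e • D.edgeExp e) :
    (monomial m 1 - monomial m' 1 : MvPolynomial E K) ∈
      Ideal.span {f | ∃ b ∈ D.lattice, f = binom K b} := by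
  have hb := (D.sum_edgeExp_eq_iff m m').mp h
  have hfac : (monomial m 1 - monomial m' 1 : MvPolynomial E K) =
      monomial (m ⊓ m') 1 * binom K (fun e => (m e : ℤ) - m' e) := by
    rw [binom, binomPlus, binomMinus, prod_X_pow_eq_monomial', prod_X_pow_eq_monomial', mul_sub,
      monomial_mul, monomial_mul, one_mul]
    congr 3
    all_goals
      ext e
      simp only [Finsupp.add_apply, Finsupp.inf_apply, Finsupp.equivFunOnFinite_symm_apply_apply]
      omega
  rw [hfac]
  exact Ideal.mul_mem_left _ _ (Ideal.subset_span ⟨_, hb, rfl⟩)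

lemma toricIdeal_le_span_binom :
    D.toricIdeal K ≤ Ideal.span {f | ∃ b ∈ D.lattice, f = binom K b} := by
  classical
  intro p hp
  induction hn : p.support.card using Nat.strong_induction_on generalizing p with
  | _ n ih =>
    by_cases h0 : p = 0
    · simp [h0]
    obtain ⟨m, hm⟩ := MvPolynomial.support_nonempty.mpr h0
    have hp' : aeval (R := K) (fun e => X (D.src e) * X (D.tgt e) ^ D.w (D.tgt e) :
      E → MvPolynomial V K) p = 0 := hp
    obtain ⟨m', hm', hne, heq⟩ : ∃ m' ∈ p.support, m' ≠ m ∧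
        ∑ e, m e • D.edgeExp e = ∑ e, m' e • D.edgeExp e := by
      by_contra! hcon
      rw [← p.support_sum_monomial_coeff, map_sum] at hp'
      simp only [aeval_monomial_eq] at hp'
      have := congrArg (coeff (∑ e, m e • D.edgeExp e)) hp'
      rw [coeff_sum, Finset.sum_eq_single_of_mem m hm, coeff_monomial, if_pos rfl] at this
      · exact (MvPolynomial.mem_support_iff.mp hm) (by simpa using this)
      · intro x hx hxm
        rw [coeff_monomial, if_neg fun h => hcon x hx hxm h.symm]
    set q : MvPolynomial E K := p - C (coeff m p) * (monomial m 1 - monomial m' 1) with hq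
    have hpq : p = q + C (coeff m p) * (monomial m 1 - monomial m' 1) := by
      rw [hq]; ring
    have hqI : q ∈ D.toricIdeal K :=
      Ideal.sub_mem _ hp (Ideal.mul_mem_left _ _
        ((D.monomial_sub_mem_toricIdeal K m m').mpr ((D.sum_edgeExp_eq_iff m m').mp heq)))
    have hcoeff : ∀ x, coeff x q = coeff x p - coeff m p * ((if m = x then 1 else 0) -
        (if m' = x then 1 else 0)) := by
      intro x
      rw [hq, coeff_sub, coeff_C_mul, coeff_sub, coeff_monomial, coeff_monomial]
    have hsub : q.support ⊆ p.support.erase m := by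
      intro x hx
      rw [MvPolynomial.mem_support_iff, hcoeff] at hx
      rw [Finset.mem_erase]
      refine ⟨fun hxm => hx (by simp [hxm, hne]), ?_⟩
      by_contra hxp
      refine hx ?_
      have h1 : m ≠ x := fun h => hxp (h ▸ hm)
      have h2 : m' ≠ x := fun h => hxp (h ▸ hm')
      simp [h1, h2, MvPolynomial.notMem_support_iff.mp hxp]
    rw [hpq]
    refine Ideal.add_mem _ (ih _ ?_ hqI rfl)
      (Ideal.mul_mem_left _ _ (D.monomial_sub_mem_span K heq))
    rw [← hn]
    exact (Finset.card_le_card hsub).trans_lt (Finset.card_erase_lt_of_mem hm)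

lemma isPrimitiveIn_iff {b : E → ℤ} : IsPrimitiveIn K (D.toricIdeal K) b ↔
    b ∈ D.lattice ∧ b ≠ 0 ∧ ∀ c ∈ D.lattice, c ≠ 0 → SignLE c b → c = b := by
  simp only [IsPrimitiveIn, binom_mem_toricIdeal]
  constructor
  · rintro ⟨h0, hb, h⟩
    refine ⟨hb, h0, fun c hc hc0 hcb => ?_⟩
    obtain ⟨h1, h2⟩ := (binomPlus_dvd_and_iff K).mpr hcb
    exact h c hc0 hc h1 h2
  · rintro ⟨hb, h0, h⟩
    exact ⟨h0, hb, fun c hc0 hc h1 h2 => h c hc hc0 ((binomPlus_dvd_and_iff K).mp ⟨h1, h2⟩)⟩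

lemma mem_circuitSet_iff {f : MvPolynomial E K} : f ∈ D.circuitSet K ↔
    ∃ b, f = binom K b ∧ IsMinSupp D.lattice b ∧
      (Finset.univ.gcd fun e => (b e).natAbs) = 1 := by
  simp only [circuitSet, Set.mem_ofPred_eq, binom_mem_toricIdeal, IsMinSupp]
  refine exists_congr fun b => ⟨?_, ?_⟩
  · rintro ⟨h1, h2, h3, h4, h5⟩
    exact ⟨h1, ⟨h3, h2, fun c hc hc0 => h5 c hc0 hc⟩, h4⟩
  · rintro ⟨h1, ⟨h3, h2, h5⟩, h4⟩
    exact ⟨h1, h2, h3, h4, fun c hc0 hc => h5 c hc hc0⟩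

lemma span_graverSet : Ideal.span (D.graverSet K) = D.toricIdeal K := by
  apply le_antisymm
  · rw [Ideal.span_le]
    rintro f ⟨b, rfl, hb⟩
    exact hb.2.1
  · refine (D.toricIdeal_le_span_binom K).trans (Ideal.span_le.mpr ?_)
    rintro f ⟨b, hb, rfl⟩
    refine Ideal.span_mono ?_ (binom_mem_span_of_primitive K hb)
    rintro f ⟨c, hc, hc0, hprim, rfl⟩
    exact ⟨c, rfl, (D.isPrimitiveIn_iff K).mpr ⟨hc, hc0, hprim⟩⟩

lemma isPrimitiveIn_of_isMinSupp {b : E → ℤ} (hb : IsMinSupp D.lattice b)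
    (hgcd : (Finset.univ.gcd fun e => (b e).natAbs) = 1) :
    IsPrimitiveIn K (D.toricIdeal K) b := by
  refine (D.isPrimitiveIn_iff K).mpr ⟨hb.1, hb.2.1, fun c hc hc0 hcb => ?_⟩
  obtain ⟨e, he⟩ := vsupp_nonempty hb.2.1
  have hcross : ∀ f, b e * c f = c e * b f := by
    intro f
    by_contra hne
    have hmem := cross_mem hc hb.1 e
    have heq := hb.2.2 _ hmem (fun h => hne (sub_eq_zero.mp (congrFun h f))) (by
      intro x hx hx0
      refine hx ?_
      have : c x = 0 := by
        by_contra hcx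
        exact hcb.vsupp_subset (show x ∈ vsupp c from hcx) hx0
      simp [this, hx0])
    have : e ∈ vsupp (fun f => b e * c f - c e * b f) := heq ▸ he
    exact this (by ring)
  obtain ⟨k, hk⟩ := exists_eq_mul_of_gcd_eq_one hgcd he fun f _ => hcross f
  have hk' : ∀ f, c f = k * b f := by
    intro f
    by_cases hf : b f = 0
    · have : c f = 0 := by
        by_contra hcx
        exact hcb.vsupp_subset (show f ∈ vsupp c from hcx) hf
      simp [this, hf]
    · exact hk f hf
  obtain ⟨x, hx⟩ := vsupp_nonempty hc0
  have hcx := hcb x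
  have hkx := hk' x
  have hx' : c x ≠ 0 := hx
  have hk1 : k = 1 := by
    have hbx : b x ≠ 0 := fun h => hx' (by rw [hkx, h, mul_zero])
    have habs : (c x).natAbs ≤ (b x).natAbs := by omega
    rw [hkx, Int.natAbs_mul] at habs
    have hkle : k.natAbs ≤ 1 :=
      Nat.le_of_mul_le_mul_right (by simpa using habs) (Int.natAbs_pos.mpr hbx)
    have : k = 1 ∨ k = 0 ∨ k = -1 := by omega
    rcases this with h | h | h
    · exact h
    · exact absurd (by rw [hkx, h, zero_mul]) hx'
    · rw [h] at hkx
      omega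
  funext f
  rw [hk' f, hk1, one_mul]

/-- If distinct minimal supports are disjoint, primitive vectors are minimal support vectors. -/
lemma isMinSupp_of_isPrimitiveIn
    (hdisj : ∀ b c, IsMinSupp D.lattice b → IsMinSupp D.lattice c → ∀ e ∈ vsupp b,
      e ∈ vsupp c → vsupp b = vsupp c) {b : E → ℤ}
    (hb : IsPrimitiveIn K (D.toricIdeal K) b) :
    IsMinSupp D.lattice b ∧ (Finset.univ.gcd fun e => (b e).natAbs) = 1 := by
  obtain ⟨hbL, hb0, hprim⟩ := (D.isPrimitiveIn_iff K).mp hb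
  obtain ⟨e, he⟩ := vsupp_nonempty hb0
  obtain ⟨c', hc', hec', hcb'⟩ := exists_isMinSupp_mem hbL he
  obtain ⟨c, hc, hs, hgcd⟩ := exists_isMinSupp_gcd_eq_one D.mem_lattice_of_smul hc'
  have hec : c e ≠ 0 := by
    have : e ∈ vsupp c := hs ▸ hec'
    exact this
  obtain ⟨k, hk⟩ := hc.exists_restrict_eq_mul hdisj hbL hgcd
  have hk0 : k ≠ 0 := by
    rintro rfl
    exact he (by rw [hk e hec, zero_mul])
  rcases lt_or_gt_of_ne hk0 with hneg | hpos
  · have hconf : SignLE (-c) b := by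
      intro x
      by_cases hx : c x = 0
      · simp [hx]
      · have := hk x hx
        simp only [Pi.neg_apply]
        rcases lt_or_gt_of_ne hx with h | h
        · have : b x ≥ - c x := by nlinarith
          omega
        · have : b x ≤ - c x := by nlinarith
          omega
    have heq := hprim (-c) (D.lattice.neg_mem hc.1) (neg_ne_zero.mpr hc.2.1) hconf
    have hv : vsupp (-c) = vsupp c := by
      ext x
      simp [vsupp]
    rw [← heq]
    refine ⟨⟨D.lattice.neg_mem hc.1, neg_ne_zero.mpr hc.2.1, ?_⟩, ?_⟩
    · rw [hv]
      exact hc.2.2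
    · simpa using hgcd
  · have hconf : SignLE c b := by
      intro x
      by_cases hx : c x = 0
      · simp [hx]
      · have := hk x hx
        rcases lt_or_gt_of_ne hx with h | h
        · have : b x ≤ c x := by nlinarith
          omega
        · have : b x ≥ c x := by nlinarith
          omega
    rw [← hprim c hc.1 hc.2.1 hconf]
    exact ⟨hc, hgcd⟩

/-- If distinct minimal supports are disjoint, the Graver basis is the set of circuits and it is
a minimal generating set. -/
lemma graverSet_eq_circuitSet_and_minimal
    (hdisj : ∀ b c, IsMinSupp D.lattice b → IsMinSupp D.lattice c → ∀ e ∈ vsupp b,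
      e ∈ vsupp c → vsupp b = vsupp c) :
    D.graverSet K = D.circuitSet K ∧
    Ideal.span (D.graverSet K) = D.toricIdeal K ∧
    ∀ f ∈ D.graverSet K,
      Ideal.span (D.graverSet K \ {f, -f}) ≠ D.toricIdeal K := by
  refine ⟨?_, D.span_graverSet K, ?_⟩
  · ext f
    rw [mem_circuitSet_iff]
    refine exists_congr fun b => and_congr_right fun _ => ⟨?_, ?_⟩
    · exact D.isMinSupp_of_isPrimitiveIn K hdisj
    · rintro ⟨h1, h2⟩
      exact D.isPrimitiveIn_of_isMinSupp K h1 h2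
  · rintro _ ⟨b, rfl, hb⟩ heq
    obtain ⟨hbmin, hbgcd⟩ := D.isMinSupp_of_isPrimitiveIn K hdisj hb
    have hprim := ((D.isPrimitiveIn_iff K).mp hb).2.2
    refine binom_notMem_span_of_disjoint K hb.1 (G := D.graverSet K \ {binom K b, -binom K b})
      ?_ (heq ▸ hb.2.1)
    rintro _ ⟨⟨c, rfl, hc⟩, hcb⟩
    refine ⟨c, rfl, ?_⟩
    rw [Set.disjoint_left]
    intro e hec heb
    obtain ⟨hcmin, hcgcd⟩ := D.isMinSupp_of_isPrimitiveIn K hdisj hc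
    have hsupp := hdisj _ _ hcmin hbmin e hec heb
    obtain ⟨k, hk⟩ := hcmin.exists_restrict_eq_mul hdisj hbmin.1 hcgcd
    obtain ⟨l, hl⟩ := hbmin.exists_restrict_eq_mul hdisj hcmin.1 hbgcd
    have hmul : k * l = 1 := by
      refine mul_right_cancel₀ (show b e ≠ 0 from heb) ?_
      rw [mul_assoc, ← hl e heb, ← hk e hec, one_mul]
    have hbk : b = k • c := by
      funext x
      by_cases hx : c x = 0
      · have : x ∉ vsupp b := hsupp ▸ (fun h => h hx)
        simpa [hx, vsupp] using this
      · simpa using hk x hx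
    refine hcb ?_
    rcases Int.eq_one_or_neg_one_of_mul_eq_one hmul with rfl | rfl
    · simp [hbk]
    · rw [hbk, neg_one_smul, binom_neg]
      simp

end ToricIdeal

end WOGraph

namespace WOGraph

section Segments

variable {V E : Type*} {D : WOGraph V E}

/-- The edge `e` joins the vertices `u` and `v`. -/
def Joins (D : WOGraph V E) (e : E) (u v : V) : Prop := s(D.src e, D.tgt e) = s(u, v)

lemma Joins.symm {e : E} {u v : V} (h : D.Joins e u v) : D.Joins e v u :=
  Eq.trans h Sym2.eq_swap

lemma Joins.ne {e : E} {u v : V} (h : D.Joins e u v) : u ≠ v := by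
  rcases Sym2.eq_iff.mp h with ⟨h1, h2⟩ | ⟨h1, h2⟩
  · exact h1 ▸ h2 ▸ D.no_loop e
  · exact h1 ▸ h2 ▸ (D.no_loop e).symm

lemma Joins.edge_eq {e e' : E} {u v : V} (h : D.Joins e u v) (h' : D.Joins e' u v) : e = e' :=
  D.no_parallel e e' (Eq.trans h (Eq.symm h'))

lemma Joins.ends_eq {e : E} {u v u' v' : V} (h : D.Joins e u v) (h' : D.Joins e u' v') :
    u = u' ∧ v = v' ∨ u = v' ∧ v = u' :=
  Sym2.eq_iff.mp (Eq.trans (Eq.symm h) h')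

lemma Joins.incident_iff {e : E} {u v x : V} (h : D.Joins e u v) :
    D.incident x e ↔ x = u ∨ x = v := by
  unfold incident
  rcases Sym2.eq_iff.mp h with ⟨h1, h2⟩ | ⟨h1, h2⟩
  · rw [h1, h2, eq_comm, @eq_comm _ v]
  · rw [h1, h2, or_comm, eq_comm, @eq_comm _ v]

lemma exists_joins_of_incident {e : E} {u : V} (h : D.incident u e) : ∃ v, D.Joins e u v := by
  rcases h with h | h
  · exact ⟨D.tgt e, h ▸ rfl⟩
  · exact ⟨D.src e, h ▸ Sym2.eq_swap⟩

/-- The first `k` edges of `g` form a path through the vertices `f 0, …, f k`. -/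
structure IsSeg (D : WOGraph V E) (f : ℕ → V) (g : ℕ → E) (k : ℕ) : Prop where
  joins : ∀ i < k, D.Joins (g i) (f i) (f (i + 1))
  inj : ∀ i ≤ k, ∀ j ≤ k, f i = f j → i = j

lemma IsSeg.edge_inj {f : ℕ → V} {g : ℕ → E} {k : ℕ} (h : IsSeg D f g k) {i j : ℕ} (hi : i < k)
    (hj : j < k) (he : g i = g j) : i = j := by
  have h1 := h.joins i hi
  rw [he] at h1
  rcases h1.ends_eq (h.joins j hj) with ⟨h2, -⟩ | ⟨h2, h3⟩
  · exact h.inj i hi.le j hj.le h2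
  · have := h.inj i hi.le (j + 1) hj h2
    have := h.inj (i + 1) hi j hj.le h3
    omega

lemma IsSeg.sub {f : ℕ → V} {g : ℕ → E} {k : ℕ} (h : IsSeg D f g k) (a l : ℕ) (hl : a + l ≤ k) :
    IsSeg D (fun i => f (a + i)) (fun i => g (a + i)) l where
  joins i hi := h.joins (a + i) (by omega)
  inj i hi j hj he := by
    have := h.inj (a + i) (by omega) (a + j) (by omega) he
    omega

lemma IsSeg.reverse {f : ℕ → V} {g : ℕ → E} {k : ℕ} (h : IsSeg D f g k) :
    IsSeg D (fun i => f (k - i)) (fun i => g (k - 1 - i)) k where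
  joins i hi := by
    have := (h.joins (k - 1 - i) (by omega)).symm
    rw [show k - 1 - i + 1 = k - i by omega] at this
    rwa [show k - (i + 1) = k - 1 - i by omega]
  inj i hi j hj he := by
    have := h.inj (k - i) (by omega) (k - j) (by omega) he
    omega

lemma image_reverse_vert (f : ℕ → V) (k : ℕ) :
    (fun i => f (k - i)) '' Set.Iic k = f '' Set.Iic k := by
  ext x
  constructor
  · rintro ⟨i, hi, rfl⟩
    exact ⟨k - i, Nat.sub_le k i, rfl⟩
  · rintro ⟨i, hi, rfl⟩
    exact ⟨k - i, Nat.sub_le k i, congrArg f (Nat.sub_sub_self hi)⟩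

lemma image_reverse_edge (g : ℕ → E) (k : ℕ) :
    (fun i => g (k - 1 - i)) '' Set.Iio k = g '' Set.Iio k := by
  ext x
  constructor
  · rintro ⟨i, hi, rfl⟩
    refine ⟨k - 1 - i, ?_, rfl⟩
    simp only [Set.mem_Iio] at hi ⊢
    omega
  · rintro ⟨i, hi, rfl⟩
    simp only [Set.mem_Iio] at hi
    refine ⟨k - 1 - i, ?_, congrArg g ?_⟩
    · simp only [Set.mem_Iio]
      omega
    · omega

/-- The path of `D` given by a segment. -/
def IsSeg.toPathIn {f : ℕ → V} {g : ℕ → E} {k : ℕ} (h : IsSeg D f g k) (hk : 1 ≤ k) :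
    PathIn D where
  k := k
  hk := hk
  vert i := f i
  edge i := g i
  vinj i j hij := Fin.ext (h.inj i (by omega) j (by omega) hij)
  einj i j hij := Fin.ext (h.edge_inj i.2 j.2 hij)
  hinc i := h.joins i i.2

lemma IsSeg.range_toPathIn_vert {f : ℕ → V} {g : ℕ → E} {k : ℕ} (h : IsSeg D f g k)
    (hk : 1 ≤ k) : Set.range (h.toPathIn hk).vert = f '' Set.Iic k := by
  ext x
  constructor
  · rintro ⟨i, rfl⟩
    exact ⟨i, Nat.lt_succ_iff.mp i.2, rfl⟩
  · rintro ⟨i, hi, rfl⟩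
    exact ⟨⟨i, Nat.lt_succ_iff.mpr hi⟩, rfl⟩

lemma IsSeg.range_toPathIn_edge {f : ℕ → V} {g : ℕ → E} {k : ℕ} (h : IsSeg D f g k)
    (hk : 1 ≤ k) : Set.range (h.toPathIn hk).edge = g '' Set.Iio k := by
  ext x
  constructor
  · rintro ⟨i, rfl⟩
    exact ⟨i, i.2, rfl⟩
  · rintro ⟨i, hi, rfl⟩
    exact ⟨⟨i, hi⟩, rfl⟩

/-- Two paths with common ends and disjoint interiors form a cycle. -/
lemma IsSeg.exists_cycle {f r : ℕ → V} {g t : ℕ → E} {a b : ℕ} (hf : IsSeg D f g a)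
    (hr : IsSeg D r t b) (ha : 1 ≤ a) (hb : 1 ≤ b) (hab : 3 ≤ a + b) (h0 : f a = r 0)
    (h1 : r b = f 0) (hdisj : ∀ i, 0 < i → i < a → ∀ j ≤ b, f i ≠ r j) :
    ∃ C : CycleIn D, Set.range C.vert = f '' Set.Iic a ∪ r '' Set.Iic b ∧
      Set.range C.edge = g '' Set.Iio a ∪ t '' Set.Iio b := by
  let vt : ℕ → V := fun i => if i < a then f i else r (i - a)
  let ed : ℕ → E := fun i => if i < a then g i else t (i - a)
  have vt_lt : ∀ i, i < a → vt i = f i := fun i hi => if_pos hi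
  have vt_ge : ∀ j, vt (a + j) = r j := fun j => by
    simp only [vt, if_neg (by omega : ¬ a + j < a), Nat.add_sub_cancel_left]
  have vt_le : ∀ i, i ≤ a → vt i = f i := fun i hi => by
    rcases hi.lt_or_eq with h | rfl
    · exact vt_lt i h
    · rw [h0]
      exact vt_ge 0
  have ed_lt : ∀ i, i < a → ed i = g i := fun i hi => if_pos hi
  have ed_ge : ∀ j, ed (a + j) = t j := fun j => by
    simp only [ed, if_neg (by omega : ¬ a + j < a), Nat.add_sub_cancel_left]
  have hcross : ∀ i j, i < a → j < b → f i ≠ r j := by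
    intro i j hi hj he
    rcases Nat.eq_zero_or_pos i with rfl | hpos
    · rw [← h1] at he
      have := hr.inj b le_rfl j hj.le he
      omega
    · exact hdisj i hpos hi j hj.le he
  have vt_inj : ∀ i j, i < a + b → j < a + b → vt i = vt j → i = j := by
    intro i j hi hj he
    rcases lt_or_ge i a with hia | hia
    · rcases lt_or_ge j a with hja | hja
      · rw [vt_lt i hia, vt_lt j hja] at he
        exact hf.inj i hia.le j hja.le he
      · obtain ⟨j, rfl⟩ := Nat.exists_eq_add_of_le hja
        rw [vt_lt i hia, vt_ge] at he
        exact absurd he (hcross i j hia (by omega))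
    · obtain ⟨i, rfl⟩ := Nat.exists_eq_add_of_le hia
      rcases lt_or_ge j a with hja | hja
      · rw [vt_lt j hja, vt_ge] at he
        exact absurd he.symm (hcross j i hja (by omega))
      · obtain ⟨j, rfl⟩ := Nat.exists_eq_add_of_le hja
        rw [vt_ge, vt_ge] at he
        rw [hr.inj i (by omega) j (by omega) he]
  have hjoin : ∀ i, i < a + b → D.Joins (ed i) (vt i) (vt ((i + 1) % (a + b))) := by
    intro i hi
    rcases lt_or_ge i a with hia | hia
    · rw [Nat.mod_eq_of_lt (by omega), vt_lt i hia, vt_le (i + 1) hia, ed_lt i hia]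
      exact hf.joins i hia
    · obtain ⟨i, rfl⟩ := Nat.exists_eq_add_of_le hia
      rcases Nat.lt_or_ge (i + 1) b with hib | hib
      · rw [Nat.mod_eq_of_lt (by omega), ed_ge, vt_ge, add_assoc, vt_ge]
        exact hr.joins i (by omega)
      · have hib' : i + 1 = b := by omega
        rw [add_assoc, hib', Nat.mod_self, ed_ge, vt_ge, vt_le 0 (by omega), ← h1, ← hib']
        exact hr.joins i (by omega)
  have hmod : ∀ i, i < a + b → (i + 1 < a + b ∧ (i + 1) % (a + b) = i + 1) ∨
      (i + 1 = a + b ∧ (i + 1) % (a + b) = 0) := by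
    intro i hi
    rcases Nat.lt_or_ge (i + 1) (a + b) with h | h
    · exact Or.inl ⟨h, Nat.mod_eq_of_lt h⟩
    · have : i + 1 = a + b := by omega
      exact Or.inr ⟨this, by rw [this, Nat.mod_self]⟩
  have ed_inj : ∀ i j, i < a + b → j < a + b → ed i = ed j → i = j := by
    intro i j hi hj he
    have hji := hjoin i hi
    rw [he] at hji
    rcases hji.ends_eq (hjoin j hj) with ⟨h2, -⟩ | ⟨h2, h3⟩
    · exact vt_inj i j hi hj h2
    · have e1 := vt_inj _ _ hi (Nat.mod_lt _ (by omega)) h2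
      have e2 := vt_inj _ _ (Nat.mod_lt _ (by omega)) hj h3
      rcases hmod i hi with ⟨_, m1⟩ | ⟨_, m1⟩ <;> rcases hmod j hj with ⟨_, m2⟩ | ⟨_, m2⟩ <;> omega
  refine ⟨{ n := a + b
            hn := hab
            vert := fun i => vt i
            edge := fun i => ed i
            vinj := fun i j h => Fin.ext (vt_inj i j i.2 j.2 h)
            einj := fun i j h => Fin.ext (ed_inj i j i.2 j.2 h)
            hinc := fun i => hjoin i i.2 }, ?_, ?_⟩
  · ext x
    constructor
    · rintro ⟨⟨i, hi⟩, rfl⟩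
      change i < a + b at hi
      rcases lt_or_ge i a with hia | hia
      · exact Or.inl ⟨i, hia.le, (vt_lt i hia).symm⟩
      · obtain ⟨i, rfl⟩ := Nat.exists_eq_add_of_le hia
        refine Or.inr ⟨i, ?_, (vt_ge i).symm⟩
        simp only [Set.mem_Iic]
        omega
    · rintro (⟨i, hi, rfl⟩ | ⟨j, hj, rfl⟩)
      · simp only [Set.mem_Iic] at hi
        exact ⟨⟨i, show i < a + b by omega⟩, vt_le i hi⟩
      · simp only [Set.mem_Iic] at hj
        rcases hj.lt_or_eq with h | h
        · exact ⟨⟨a + j, show a + j < a + b by omega⟩, vt_ge j⟩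
        · exact ⟨⟨0, show 0 < a + b by omega⟩, (vt_le 0 (by omega)).trans (h ▸ h1.symm)⟩
  · ext x
    constructor
    · rintro ⟨⟨i, hi⟩, rfl⟩
      change i < a + b at hi
      rcases lt_or_ge i a with hia | hia
      · exact Or.inl ⟨i, hia, (ed_lt i hia).symm⟩
      · obtain ⟨i, rfl⟩ := Nat.exists_eq_add_of_le hia
        refine Or.inr ⟨i, ?_, (ed_ge i).symm⟩
        simp only [Set.mem_Iio]
        omega
    · rintro (⟨i, hi, rfl⟩ | ⟨j, hj, rfl⟩)
      · simp only [Set.mem_Iio] at hi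
        exact ⟨⟨i, show i < a + b by omega⟩, ed_lt i hi⟩
      · simp only [Set.mem_Iio] at hj
        exact ⟨⟨a + j, show a + j < a + b by omega⟩, ed_ge j⟩

/-- A periodic parametrization of a cycle of length `n`. -/
structure IsLoop (D : WOGraph V E) (f : ℕ → V) (g : ℕ → E) (n : ℕ) : Prop where
  three_le : 3 ≤ n
  joins : ∀ i, D.Joins (g i) (f i) (f (i + 1))
  inj (i j : ℕ) : f i = f j → i ≡ j [MOD n]
  vert_per (i j : ℕ) : i ≡ j [MOD n] → f i = f j
  edge_per (i j : ℕ) : i ≡ j [MOD n] → g i = g j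

lemma IsLoop.shift {f : ℕ → V} {g : ℕ → E} {n : ℕ} (h : IsLoop D f g n) (a : ℕ) :
    IsLoop D (fun i => f (a + i)) (fun i => g (a + i)) n where
  three_le := h.three_le
  joins i := h.joins (a + i)
  inj _ _ he := Nat.ModEq.add_left_cancel' a (h.inj _ _ he)
  vert_per _ _ he := h.vert_per _ _ (he.add_left a)
  edge_per _ _ he := h.edge_per _ _ (he.add_left a)

lemma IsLoop.eq_of_lt {f : ℕ → V} {g : ℕ → E} {n : ℕ} (h : IsLoop D f g n) {a i j : ℕ}
    (hi : a ≤ i) (hi' : i < a + n) (hj : a ≤ j) (hj' : j < a + n) (he : f i = f j) : i = j := by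
  obtain ⟨i, rfl⟩ := Nat.exists_eq_add_of_le hi
  obtain ⟨j, rfl⟩ := Nat.exists_eq_add_of_le hj
  have := Nat.ModEq.eq_of_lt_of_lt ((h.shift a).inj i j he) (by omega) (by omega)
  omega

lemma IsLoop.edge_inj {f : ℕ → V} {g : ℕ → E} {n : ℕ} (h : IsLoop D f g n) {i j : ℕ}
    (he : g i = g j) : i ≡ j [MOD n] := by
  have h1 := h.joins i
  rw [he] at h1
  rcases h1.ends_eq (h.joins j) with ⟨h2, -⟩ | ⟨h2, h3⟩
  · exact h.inj _ _ h2
  · exfalso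
    have e1 : i + 2 ≡ i [MOD n] := ((h.inj _ _ h3).add_right 1).trans (h.inj _ _ h2).symm
    have e2 : (2 : ℕ) ≡ 0 [MOD n] := Nat.ModEq.add_left_cancel' i e1
    have := Nat.ModEq.eq_of_lt_of_lt e2 (by have := h.three_le; omega)
      (by have := h.three_le; omega)
    omega

lemma IsLoop.edge_eq_of_lt {f : ℕ → V} {g : ℕ → E} {n : ℕ} (h : IsLoop D f g n) {a i j : ℕ}
    (hi : a ≤ i) (hi' : i < a + n) (hj : a ≤ j) (hj' : j < a + n) (he : g i = g j) : i = j :=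
  h.eq_of_lt hi hi' hj hj' (h.vert_per _ _ (h.edge_inj he))

lemma IsLoop.isSeg {f : ℕ → V} {g : ℕ → E} {n : ℕ} (h : IsLoop D f g n) (a k : ℕ) (hk : k < n) :
    IsSeg D (fun i => f (a + i)) (fun i => g (a + i)) k where
  joins i _ := h.joins (a + i)
  inj i hi j hj he := by
    have := h.eq_of_lt (a := a) (by omega) (by omega) (by omega) (by omega) he
    omega

lemma IsLoop.exists_shift_eq {f : ℕ → V} {g : ℕ → E} {n : ℕ} (h : IsLoop D f g n) (a i : ℕ) :
    ∃ j < n, a + j ≡ i [MOD n] := by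
  have hn : 0 < n := by have := h.three_le; omega
  refine ⟨(i + (n - 1) * a) % n, Nat.mod_lt _ hn, ?_⟩
  have h1 : a + (i + (n - 1) * a) % n ≡ a + (i + (n - 1) * a) [MOD n] :=
    (Nat.mod_modEq _ _).add_left a
  refine h1.trans ?_
  have : a + (i + (n - 1) * a) = i + n * a := by
    obtain ⟨m, rfl⟩ : ∃ m, n = m + 1 := ⟨n - 1, by omega⟩
    simp only [Nat.add_sub_cancel]
    ring
  rw [this]
  simp [Nat.ModEq]

lemma IsLoop.range_shift {f : ℕ → V} {g : ℕ → E} {n : ℕ} (h : IsLoop D f g n) (a : ℕ) :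
    Set.range (fun i => f (a + i)) = Set.range f ∧
      Set.range (fun i => g (a + i)) = Set.range g := by
  constructor <;> ext x <;> constructor
  · rintro ⟨i, rfl⟩
    exact ⟨a + i, rfl⟩
  · rintro ⟨i, rfl⟩
    obtain ⟨j, -, hj⟩ := h.exists_shift_eq a i
    exact ⟨j, h.vert_per _ _ hj⟩
  · rintro ⟨i, rfl⟩
    exact ⟨a + i, rfl⟩
  · rintro ⟨i, rfl⟩
    obtain ⟨j, -, hj⟩ := h.exists_shift_eq a i
    exact ⟨j, h.edge_per _ _ hj⟩

lemma CycleIn.exists_isLoop (C : CycleIn D) :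
    ∃ f g, IsLoop D f g C.n ∧ Set.range f = Set.range C.vert ∧
      Set.range g = Set.range C.edge := by
  have hn : 0 < C.n := by have := C.hn; omega
  refine ⟨fun i => C.vert ⟨i % C.n, Nat.mod_lt _ hn⟩, fun i => C.edge ⟨i % C.n, Nat.mod_lt _ hn⟩,
    ⟨C.hn, fun i => ?_, fun i j he => ?_, fun i j he => ?_, fun i j he => ?_⟩, ?_, ?_⟩
  · have := C.hinc ⟨i % C.n, Nat.mod_lt _ hn⟩
    simpa [finRot, Joins] using this
  · exact congrArg Fin.val (C.vinj he)
  · exact congrArg C.vert (Fin.ext he)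
  · exact congrArg C.edge (Fin.ext he)
  · ext x
    constructor
    · rintro ⟨i, rfl⟩
      exact ⟨_, rfl⟩
    · rintro ⟨i, rfl⟩
      exact ⟨i, congrArg C.vert (Fin.ext (Nat.mod_eq_of_lt i.2))⟩
  · ext x
    constructor
    · rintro ⟨i, rfl⟩
      exact ⟨_, rfl⟩
    · rintro ⟨i, rfl⟩
      exact ⟨i, congrArg C.edge (Fin.ext (Nat.mod_eq_of_lt i.2))⟩

lemma CycleIn.exists_isLoop_vert (C : CycleIn D) {v : V} (hv : v ∈ Set.range C.vert) :
    ∃ f g, IsLoop D f g C.n ∧ Set.range f = Set.range C.vert ∧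
      Set.range g = Set.range C.edge ∧ f 0 = v := by
  obtain ⟨f, g, h, hf, hg⟩ := C.exists_isLoop
  rw [← hf] at hv
  obtain ⟨a, rfl⟩ := hv
  exact ⟨_, _, h.shift a, (h.range_shift a).1.trans hf, (h.range_shift a).2.trans hg, rfl⟩

lemma CycleIn.exists_isLoop_edge (C : CycleIn D) {e : E} (he : e ∈ Set.range C.edge) :
    ∃ f g, IsLoop D f g C.n ∧ Set.range f = Set.range C.vert ∧
      Set.range g = Set.range C.edge ∧ g 0 = e := by
  obtain ⟨f, g, h, hf, hg⟩ := C.exists_isLoop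
  rw [← hg] at he
  obtain ⟨a, rfl⟩ := he
  exact ⟨_, _, h.shift a, (h.range_shift a).1.trans hf, (h.range_shift a).2.trans hg, rfl⟩

lemma CycleIn.mem_range_vert (C : CycleIn D) {e : E} {u v : V} (he : e ∈ Set.range C.edge)
    (h : D.Joins e u v) : u ∈ Set.range C.vert ∧ v ∈ Set.range C.vert := by
  obtain ⟨i, rfl⟩ := he
  rcases h.ends_eq (C.hinc i) with ⟨rfl, rfl⟩ | ⟨rfl, rfl⟩
  · exact ⟨⟨_, rfl⟩, ⟨_, rfl⟩⟩
  · exact ⟨⟨_, rfl⟩, ⟨_, rfl⟩⟩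

lemma sharePath_of_union {C C₁ : CycleIn D} {P : PathIn D} {EA EB ER : Set E} {VA VB VR : Set V}
    (hCv : Set.range C.vert = VA ∪ VB) (hCe : Set.range C.edge = EA ∪ EB)
    (hDv : Set.range C₁.vert = VA ∪ VR) (hDe : Set.range C₁.edge = EA ∪ ER)
    (hPv : Set.range P.vert = VA) (hPe : Set.range P.edge = EA)
    (he : ∀ x ∈ EB, x ∉ ER) (hv : ∀ x ∈ VB, x ∈ VR → x ∈ VA) : SharePath C C₁ P := by
  refine ⟨?_, ?_, ?_, ?_⟩
  · rw [hPe, hCe]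
    exact Set.subset_union_left
  · rw [hPe, hDe]
    exact Set.subset_union_left
  · rw [hPe, hDe, hCe]
    ext x
    have := he x
    simp only [Set.mem_inter_iff, Set.mem_union]
    tauto
  · rw [hPv, hDv, hCv]
    ext x
    have := hv x
    simp only [Set.mem_inter_iff, Set.mem_union]
    tauto

/-- A cycle together with an ear contains two further cycles through the ear; any two of the three
cycles share exactly a path. -/
lemma CycleIn.theta (C : CycleIn D) {r : ℕ → V} {t : ℕ → E} {k : ℕ} (hR : IsSeg D r t k)
    (hk : 1 ≤ k) (h0 : r 0 ∈ Set.range C.vert) (hl : r k ∈ Set.range C.vert)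
    (hint : ∀ j, 0 < j → j < k → r j ∉ Set.range C.vert)
    (hedge : ∀ j < k, t j ∉ Set.range C.edge) :
    ∃ C₁ C₂ : CycleIn D, (∃ P, SharePath C C₁ P) ∧ (∃ P, SharePath C C₂ P) ∧
      (∃ P, SharePath C₁ C₂ P) ∧
      Set.range C₁.edge ⊆ Set.range C.edge ∪ t '' Set.Iio k ∧
      Set.range C₂.edge ⊆ Set.range C.edge ∪ t '' Set.Iio k ∧
      t '' Set.Iio k ⊆ Set.range C₁.edge ∧ t '' Set.Iio k ⊆ Set.range C₂.edge ∧
      Set.range C₁.edge ≠ Set.range C₂.edge := by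
  obtain ⟨f, g, hL, hfv, hge, hf0⟩ := C.exists_isLoop_vert h0
  have hn := hL.three_le
  set n := C.n
  obtain ⟨a, han, hfa⟩ : ∃ a < n, f a = r k := by
    rw [← hfv] at hl
    obtain ⟨i, hi⟩ := hl
    obtain ⟨j, hj, hji⟩ := hL.exists_shift_eq 0 i
    exact ⟨j, hj, by rw [← hi, ← hL.vert_per _ _ hji, zero_add]⟩
  have ha0 : 0 < a := by
    rcases Nat.eq_zero_or_pos a with rfl | h
    · have := hR.inj 0 (by omega) k le_rfl (hf0.symm.trans hfa)
      omega
    · exact h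
  have hfn : f (a + (n - a)) = f 0 := hL.vert_per _ _ (by
    rw [Nat.add_sub_cancel' han.le]
    simp [Nat.ModEq])
  have hfmem : ∀ i, f i ∈ Set.range C.vert := fun i => hfv ▸ ⟨i, rfl⟩
  have hgmem : ∀ i, g i ∈ Set.range C.edge := fun i => hge ▸ ⟨i, rfl⟩
  have hA : IsSeg D f g a := by simpa using hL.isSeg 0 a han
  have hB : IsSeg D (fun i => f (a + i)) (fun i => g (a + i)) (n - a) := hL.isSeg a _ (by omega)
  have hRr := hR.reverse
  have hlen1 : 3 ≤ a + k := by
    by_contra hlt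
    have ha1 : a = 1 := by omega
    have hk1 : k = 1 := by omega
    subst ha1 hk1
    have h2 := hR.joins 0 one_pos
    have h3 := hL.joins 0
    rw [zero_add] at h2 h3
    rw [hf0, hfa] at h3
    exact hedge 0 one_pos (h2.edge_eq h3 ▸ hgmem 0)
  have hlen2 : 3 ≤ n - a + k := by
    by_contra hlt
    have hk1 : k = 1 := by omega
    have h2 := hR.joins 0 (by omega)
    have h3 := hL.joins a
    rw [show a + 1 = a + (n - a) by omega, hfn, hf0, hfa] at h3
    rw [zero_add, ← hk1] at h2
    exact hedge 0 (by omega) (h2.symm.edge_eq h3 ▸ hgmem a)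
  have hRmeet : ∀ i j, j ≤ k → f i = r j → f i = f 0 ∨ f i = f a := by
    intro i j hj he
    rcases Nat.eq_zero_or_pos j with rfl | hj0
    · exact Or.inl (he.trans hf0.symm)
    · rcases hj.lt_or_eq with h | rfl
      · exact absurd (he ▸ hfmem i) (hint j hj0 h)
      · exact Or.inr (he.trans hfa.symm)
  obtain ⟨C₁, hv1, he1⟩ := hA.exists_cycle hRr ha0 hk hlen1 (by simpa using hfa)
    (by simpa using hf0.symm) (by
      intro i hi0 hia j hj he
      rcases hRmeet i (k - j) (by omega) he with h | h
      · have := hA.inj i hia.le 0 (by omega) h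
        omega
      · have := hA.inj i hia.le a le_rfl h
        omega)
  rw [image_reverse_vert] at hv1
  rw [image_reverse_edge] at he1
  obtain ⟨C₂, hv2, he2⟩ := hB.exists_cycle hR (by omega) hk hlen2 (by simp [hfn, hf0])
    (by simpa using hfa.symm) (by
      intro i hi0 hia j hj he
      rcases hRmeet (a + i) j hj he with h | h
      · rw [← hfn] at h
        have := hB.inj i hia.le (n - a) le_rfl h
        omega
      · have := hB.inj i hia.le 0 (by omega) h
        omega)
  set EA := g '' Set.Iio a with hEA
  set EB := (fun i => g (a + i)) '' Set.Iio (n - a) with hEB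
  set ER := t '' Set.Iio k with hER
  set VA := f '' Set.Iic a with hVA
  set VB := (fun i => f (a + i)) '' Set.Iic (n - a) with hVB
  set VR := r '' Set.Iic k with hVR
  have hCe : Set.range C.edge = EA ∪ EB := by
    rw [← hge]
    ext x
    constructor
    · rintro ⟨i, rfl⟩
      obtain ⟨j, hj, hji⟩ := hL.exists_shift_eq 0 i
      rw [zero_add] at hji
      rw [← hL.edge_per _ _ hji]
      rcases lt_or_ge j a with h | h
      · exact Or.inl ⟨j, h, rfl⟩
      · refine Or.inr ⟨j - a, ?_, congrArg g (by omega)⟩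
        simp only [Set.mem_Iio]
        omega
    · rintro (⟨i, -, rfl⟩ | ⟨i, -, rfl⟩)
      · exact ⟨i, rfl⟩
      · exact ⟨a + i, rfl⟩
  have hCv : Set.range C.vert = VA ∪ VB := by
    rw [← hfv]
    ext x
    constructor
    · rintro ⟨i, rfl⟩
      obtain ⟨j, hj, hji⟩ := hL.exists_shift_eq 0 i
      rw [zero_add] at hji
      rw [← hL.vert_per _ _ hji]
      rcases lt_or_ge j a with h | h
      · exact Or.inl ⟨j, h.le, rfl⟩
      · refine Or.inr ⟨j - a, ?_, congrArg f (by omega)⟩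
        simp only [Set.mem_Iic]
        omega
    · rintro (⟨i, -, rfl⟩ | ⟨i, -, rfl⟩)
      · exact ⟨i, rfl⟩
      · exact ⟨a + i, rfl⟩
  have hEAB : ∀ x ∈ EA, x ∉ EB := by
    rintro _ ⟨i, hi, rfl⟩ ⟨j, hj, he⟩
    simp only [Set.mem_Iio] at hi hj
    have := hL.edge_eq_of_lt (a := 0) (by omega) (by omega) (by omega) (by omega) he
    omega
  have hEAR : ∀ x ∈ EA, x ∉ ER := by
    rintro _ ⟨i, hi, rfl⟩ ⟨j, hj, he⟩
    exact hedge j hj (he ▸ hgmem i)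
  have hEBR : ∀ x ∈ EB, x ∉ ER := by
    rintro _ ⟨i, hi, rfl⟩ ⟨j, hj, he⟩
    exact hedge j hj (he ▸ hgmem (a + i))
  have hends : ∀ x, x = f 0 ∨ x = f a → x ∈ VA ∧ x ∈ VB ∧ x ∈ VR := by
    rintro x (rfl | rfl)
    · exact ⟨⟨0, Nat.zero_le a, rfl⟩, ⟨n - a, le_refl (n - a), hfn⟩, ⟨0, Nat.zero_le k, hf0.symm⟩⟩
    · exact ⟨⟨a, le_refl a, rfl⟩, ⟨0, Nat.zero_le _, rfl⟩, ⟨k, le_refl k, hfa.symm⟩⟩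
  have hVAB : ∀ x ∈ VA, x ∈ VB → x = f 0 ∨ x = f a := by
    rintro _ ⟨i, hi, rfl⟩ ⟨j, hj, he⟩
    simp only [Set.mem_Iic] at hi hj
    rcases Nat.lt_or_ge (a + j) n with h | h
    · have := hL.eq_of_lt (a := 0) (by omega) (by omega) (by omega) (by omega) he
      exact Or.inr (congrArg f (by omega))
    · left
      rw [← he, ← hfn]
      exact congrArg f (by omega)
  have hVAR : ∀ x ∈ VA, x ∈ VR → x = f 0 ∨ x = f a := by
    rintro _ ⟨i, hi, rfl⟩ ⟨j, hj, he⟩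
    exact hRmeet i j hj he.symm
  have hVBR : ∀ x ∈ VB, x ∈ VR → x = f 0 ∨ x = f a := by
    rintro _ ⟨i, hi, rfl⟩ ⟨j, hj, he⟩
    exact hRmeet (a + i) j hj he.symm
  refine ⟨C₁, C₂, ⟨hA.toPathIn ha0, ?_⟩, ⟨hB.toPathIn (by omega), ?_⟩, ⟨hR.toPathIn hk, ?_⟩,
    ?_, ?_, ?_, ?_, ?_⟩
  · exact sharePath_of_union hCv hCe hv1 he1 (hA.range_toPathIn_vert _) (hA.range_toPathIn_edge _)
      hEBR fun x hx hx' => (hends x (hVBR x hx hx')).1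
  · exact sharePath_of_union (hCv.trans (Set.union_comm _ _)) (hCe.trans (Set.union_comm _ _))
      hv2 he2 (hB.range_toPathIn_vert _) (hB.range_toPathIn_edge _)
      hEAR fun x hx hx' => (hends x (hVAR x hx hx')).2.1
  · exact sharePath_of_union (hv1.trans (Set.union_comm _ _)) (he1.trans (Set.union_comm _ _))
      (hv2.trans (Set.union_comm _ _)) (he2.trans (Set.union_comm _ _))
      (hR.range_toPathIn_vert _) (hR.range_toPathIn_edge _)
      hEAB fun x hx hx' => (hends x (hVAB x hx hx')).2.2
  · rw [he1, hCe]
    exact Set.union_subset_union_left _ Set.subset_union_left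
  · rw [he2, hCe]
    exact Set.union_subset_union_left _ Set.subset_union_right
  · rw [he1]
    exact Set.subset_union_right
  · rw [he2]
    exact Set.subset_union_right
  · rw [he1, he2]
    intro h
    have hg0 : g 0 ∈ EA := ⟨0, ha0, rfl⟩
    have hmem : g 0 ∈ EB ∪ ER := h ▸ Set.mem_union_left _ hg0
    rcases hmem with h' | h'
    · exact hEAB _ hg0 h'
    · exact hEAR _ hg0 h'

end Segments

end WOGraph

namespace WOGraph

section Cycles

variable {V E : Type*} {D : WOGraph V E}

/-- An edge of a loop outside the cycle `C` lies on an ear of `C` contained in the loop. -/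
lemma IsLoop.exists_ear {z : ℕ → V} {y : ℕ → E} {n : ℕ} (hZ : IsLoop D z y n) (C : CycleIn D)
    {lo hi i : ℕ} (h1 : lo ≤ i) (h2 : i < hi) (hlo : z lo ∈ Set.range C.vert)
    (hhi : z hi ∈ Set.range C.vert) (hyi : y i ∉ Set.range C.edge) :
    ∃ a b, lo ≤ a ∧ a ≤ i ∧ i < b ∧ b ≤ hi ∧ z a ∈ Set.range C.vert ∧ z b ∈ Set.range C.vert ∧
      (∀ j, a < j → j < b → z j ∉ Set.range C.vert) ∧
      ∀ j, a ≤ j → j < b → y j ∉ Set.range C.edge := by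
  classical
  have hexb : ∃ b, i < b ∧ z b ∈ Set.range C.vert := ⟨hi, h2, hhi⟩
  have hexa : ∃ d, d ≤ i ∧ z (i - d) ∈ Set.range C.vert :=
    ⟨i - lo, by omega, by rwa [Nat.sub_sub_self h1]⟩
  obtain ⟨hb1, hb2⟩ := Nat.find_spec hexb
  obtain ⟨ha1, ha2⟩ := Nat.find_spec hexa
  have hbmin : Nat.find hexb ≤ hi := Nat.find_min' hexb ⟨h2, hhi⟩
  have hamin : Nat.find hexa ≤ i - lo :=
    Nat.find_min' hexa ⟨by omega, by rwa [Nat.sub_sub_self h1]⟩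
  have hint : ∀ j, i - Nat.find hexa < j → j < Nat.find hexb → z j ∉ Set.range C.vert := by
    intro j hj1 hj2 hmem
    rcases lt_or_ge i j with h | h
    · exact Nat.find_min hexb hj2 ⟨h, hmem⟩
    · exact Nat.find_min hexa (show i - j < _ by omega)
        ⟨by omega, by rwa [Nat.sub_sub_self h]⟩
  refine ⟨_, _, by omega, by omega, hb1, hbmin, ha2, hb2, hint, fun j hj1 hj2 hmem => ?_⟩
  obtain ⟨hv1, hv2⟩ := C.mem_range_vert hmem (hZ.joins j)
  by_cases hja : j = i - Nat.find hexa
  · by_cases hjb : j + 1 = Nat.find hexb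
    · have : j = i := by omega
      exact hyi (this ▸ hmem)
    · exact hint (j + 1) (by omega) (by omega) hv2
  · exact hint j (by omega) hj2 hv1

/-- The two cycles through an ear of `C` cut out of a loop. -/
lemma IsLoop.theta_of_ear {z : ℕ → V} {y : ℕ → E} {n : ℕ} (hZ : IsLoop D z y n) (C : CycleIn D)
    {a b : ℕ} (hab : a < b) (hbn : b < a + n) (ha : z a ∈ Set.range C.vert)
    (hb : z b ∈ Set.range C.vert) (hint : ∀ j, a < j → j < b → z j ∉ Set.range C.vert)
    (hedge : ∀ j, a ≤ j → j < b → y j ∉ Set.range C.edge) :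
    ∃ C₁ C₂ : CycleIn D, (∃ P, SharePath C C₁ P) ∧ (∃ P, SharePath C C₂ P) ∧
      (∃ P, SharePath C₁ C₂ P) ∧
      Set.range C₁.edge ⊆ Set.range C.edge ∪ y '' Set.Ico a b ∧
      Set.range C₂.edge ⊆ Set.range C.edge ∪ y '' Set.Ico a b ∧
      y '' Set.Ico a b ⊆ Set.range C₁.edge ∧ y '' Set.Ico a b ⊆ Set.range C₂.edge ∧
      Set.range C₁.edge ≠ Set.range C₂.edge := by
  have himg : (fun i => y (a + i)) '' Set.Iio (b - a) = y '' Set.Ico a b := by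
    ext x
    constructor
    · rintro ⟨i, hi, rfl⟩
      simp only [Set.mem_Iio] at hi
      exact ⟨a + i, ⟨by omega, by omega⟩, rfl⟩
    · rintro ⟨i, ⟨hi1, hi2⟩, rfl⟩
      refine ⟨i - a, ?_, congrArg y (by omega)⟩
      simp only [Set.mem_Iio]
      omega
  rw [← himg]
  refine C.theta (hZ.isSeg a (b - a) (by omega)) (by omega) ha ?_ ?_ ?_
  · simpa [Nat.add_sub_cancel' hab.le] using hb
  · exact fun j h0 hj => hint (a + j) (by omega) (by omega)
  · exact fun j hj => hedge (a + j) (by omega) (by omega)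

/-- If `Z` shares an edge with `C` but is not contained in it, then either the two cycles share
exactly a path, or `Z` contains two disjoint ears of `C`. -/
lemma CycleIn.exists_theta (C Z : CycleIn D) {e e' : E} (he : e ∈ Set.range C.edge)
    (heZ : e ∈ Set.range Z.edge) (he' : e' ∈ Set.range Z.edge) (hnC : e' ∉ Set.range C.edge) :
    ∃ C₁ C₂ : CycleIn D, (∃ P, SharePath C C₁ P) ∧ (∃ P, SharePath C C₂ P) ∧
      (∃ P, SharePath C₁ C₂ P) ∧
      Set.range C₁.edge ⊆ Set.range C.edge ∪ Set.range Z.edge ∧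
      Set.range C₂.edge ⊆ Set.range C.edge ∪ Set.range Z.edge ∧
      Set.range C₁.edge ≠ Set.range C.edge ∧ Set.range C₂.edge ≠ Set.range C.edge ∧
      Set.range C₁.edge ≠ Set.range C₂.edge ∧
      ((∃ P, SharePath C Z P) ∨ ∃ C₃ : CycleIn D, (∃ P, SharePath C C₃ P) ∧
        Set.range C₃.edge ≠ Set.range C₁.edge ∧ Set.range C₃.edge ≠ Set.range C₂.edge) := by
  obtain ⟨z, y, hZ, hzv, hye, hy0⟩ := Z.exists_isLoop_edge heZ
  have hn := hZ.three_le
  set n := Z.n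
  have hymem : ∀ i, y i ∈ Set.range Z.edge := fun i => hye ▸ ⟨i, rfl⟩
  have hj0 := hZ.joins 0
  rw [hy0, zero_add] at hj0
  obtain ⟨hz0, hz1⟩ := C.mem_range_vert he hj0
  have hzn : z n = z 0 := hZ.vert_per _ _ (by simp [Nat.ModEq])
  obtain ⟨i, hin, hi⟩ : ∃ i < n, y i = e' := by
    rw [← hye] at he'
    obtain ⟨i, rfl⟩ := he'
    obtain ⟨j, hj, hji⟩ := hZ.exists_shift_eq 0 i
    exact ⟨j, hj, by rw [← hZ.edge_per _ _ hji, zero_add]⟩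
  have hi0 : 1 ≤ i := by
    rcases Nat.eq_zero_or_pos i with rfl | h
    · exact absurd (hi ▸ hy0 ▸ he) hnC
    · exact h
  obtain ⟨a, b, ha1, hai, hib, hbn, hza, hzb, hint, hedge⟩ :=
    hZ.exists_ear C hi0 hin hz1 (hzn ▸ hz0) (hi ▸ hnC)
  obtain ⟨C₁, C₂, hP1, hP2, hP12, hs1, hs2, ht1, ht2, hne⟩ :=
    hZ.theta_of_ear C (by omega) (by omega) hza hzb hint hedge
  have hyR : y '' Set.Ico a b ⊆ Set.range Z.edge := by
    rintro _ ⟨j, -, rfl⟩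
    exact hymem j
  have hiR : y i ∈ y '' Set.Ico a b := ⟨i, ⟨hai, hib⟩, rfl⟩
  refine ⟨C₁, C₂, hP1, hP2, hP12, hs1.trans (Set.union_subset_union_right _ hyR),
    hs2.trans (Set.union_subset_union_right _ hyR), ?_, ?_, hne, ?_⟩
  · exact fun h => (hi ▸ hnC) (h ▸ ht1 hiR)
  · exact fun h => (hi ▸ hnC) (h ▸ ht2 hiR)
  by_cases hrest : ∀ j, b ≤ j → j < a + n → y j ∈ Set.range C.edge
  · left
    have hseg := hZ.isSeg b (a + n - b) (by omega)
    have hPv := hseg.range_toPathIn_vert (by omega)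
    have hPe := hseg.range_toPathIn_edge (by omega)
    refine ⟨hseg.toPathIn (by omega), ?_, ?_, ?_, ?_⟩
    · rw [hPe]
      rintro _ ⟨j, hj, rfl⟩
      simp only [Set.mem_Iio] at hj
      exact hrest _ (by omega) (by omega)
    · rw [hPe]
      rintro _ ⟨j, hj, rfl⟩
      exact hymem _
    · rw [hPe]
      ext x
      constructor
      · rintro ⟨hxC, hxZ⟩
        rw [← hye] at hxZ
        obtain ⟨m, rfl⟩ := hxZ
        obtain ⟨j, hj, hjm⟩ := hZ.exists_shift_eq a m
        rw [← hZ.edge_per _ _ hjm] at hxC ⊢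
        rcases lt_or_ge (a + j) b with h | h
        · exact absurd hxC (hedge _ (by omega) h)
        · refine ⟨a + j - b, ?_, congrArg y (by omega)⟩
          simp only [Set.mem_Iio]
          omega
      · rintro ⟨j, hj, rfl⟩
        simp only [Set.mem_Iio] at hj
        exact ⟨hrest _ (by omega) (by omega), hymem _⟩
    · rw [hPv]
      ext x
      constructor
      · rintro ⟨hxC, hxZ⟩
        rw [← hzv] at hxZ
        obtain ⟨m, rfl⟩ := hxZ
        obtain ⟨j, hj, hjm⟩ := hZ.exists_shift_eq a m
        rw [← hZ.vert_per _ _ hjm] at hxC ⊢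
        rcases lt_or_ge (a + j) b with h | h
        · have hj0 : j = 0 := by
            by_contra h0
            exact hint _ (by omega) h hxC
          subst hj0
          refine ⟨a + n - b, le_refl (a + n - b), ?_⟩
          refine hZ.vert_per _ _ ?_
          rw [Nat.add_sub_cancel' (by omega)]
          simp [Nat.ModEq]
        · refine ⟨a + j - b, ?_, congrArg z (by omega)⟩
          simp only [Set.mem_Iic]
          omega
      · rintro ⟨j, hj, rfl⟩
        simp only [Set.mem_Iic] at hj
        refine ⟨?_, hzv ▸ ⟨b + j, rfl⟩⟩
        rcases Nat.eq_zero_or_pos j with rfl | hj0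
        · exact hzb
        · have hmem := hrest (b + (j - 1)) (by omega) (by omega)
          have := (C.mem_range_vert hmem (hZ.joins _)).2
          rwa [show b + (j - 1) + 1 = b + j by omega] at this
  · right
    push Not at hrest
    obtain ⟨j, hbj, hjn, hj⟩ := hrest
    have hzan : z (a + n) = z a := hZ.vert_per _ _ (by simp [Nat.ModEq])
    obtain ⟨a', b', ha1', hai', hib', hbn', hza', hzb', hint', hedge'⟩ :=
      hZ.exists_ear C hbj hjn hzb (hzan ▸ hza) hj
    obtain ⟨C₃, -, hP3, -, -, hs3, -⟩ :=
      hZ.theta_of_ear C (by omega) (by omega) hza' hzb' hint' hedge'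
    have hnot : y i ∉ Set.range C₃.edge := by
      intro hmem
      rcases hs3 hmem with h | ⟨l, ⟨hl1, hl2⟩, h⟩
      · exact (hi ▸ hnC) h
      · have := hZ.edge_eq_of_lt (a := a) (by omega) (by omega) (by omega) (by omega) h
        omega
    exact ⟨C₃, hP3, fun h => hnot (h ▸ ht1 hiR), fun h => hnot (h ▸ ht2 hiR)⟩

/-- No vertex has exactly one incident edge in `H`. -/
def NoLeafIn (D : WOGraph V E) (H : Set E) : Prop :=
  ∀ e ∈ H, ∀ v, D.incident v e → ∃ e' ∈ H, e' ≠ e ∧ D.incident v e'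

lemma CycleIn.noLeafIn (C : CycleIn D) : NoLeafIn D (Set.range C.edge) := by
  intro e he v hv
  obtain ⟨f, g, hL, -, hge, hg0⟩ := C.exists_isLoop_edge he
  have hn := hL.three_le
  set n := C.n
  rw [← hge]
  have h0 := hL.joins 0
  rw [hg0] at h0
  rcases h0.incident_iff.mp hv with rfl | rfl
  · refine ⟨g (n - 1), ⟨_, rfl⟩, fun h => ?_, ?_⟩
    · have := hL.edge_eq_of_lt (a := 0) (by omega) (by omega) (by omega) (by omega) (hg0.trans h.symm)
      omega
    · refine (hL.joins (n - 1)).incident_iff.mpr (Or.inr (hL.vert_per _ _ ?_))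
      rw [Nat.sub_add_cancel (by omega)]
      simp [Nat.ModEq]
  · refine ⟨g 1, ⟨_, rfl⟩, fun h => ?_, (hL.joins 1).incident_iff.mpr (Or.inl rfl)⟩
    have := hL.edge_eq_of_lt (a := 0) (by omega) (by omega) (by omega) (by omega) (hg0.trans h.symm)
    omega

/-- A cycle contains no proper nonempty leafless subgraph. -/
lemma CycleIn.eq_of_noLeafIn (C : CycleIn D) {H : Set E} (hH : NoLeafIn D H)
    (hne : H.Nonempty) (hsub : H ⊆ Set.range C.edge) : H = Set.range C.edge := by
  refine hsub.antisymm ?_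
  obtain ⟨e, he⟩ := hne
  obtain ⟨f, g, hL, -, hge, hg0⟩ := C.exists_isLoop_edge (hsub he)
  have hall : ∀ i, g i ∈ H := by
    intro i
    induction i with
    | zero => exact hg0 ▸ he
    | succ i ih =>
      obtain ⟨e', he', hne', hinc⟩ :=
        hH (g i) ih (f (i + 1)) ((hL.joins i).incident_iff.mpr (Or.inr rfl))
      obtain ⟨j, rfl⟩ : e' ∈ Set.range g := hge ▸ hsub he'
      rcases (hL.joins j).incident_iff.mp hinc with h | h
      · rwa [hL.edge_per _ _ (hL.inj _ _ h)]
      · exact absurd (hL.edge_per _ _ (Nat.ModEq.add_right_cancel' 1 (hL.inj _ _ h))).symm hne'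
  rw [← hge]
  rintro _ ⟨i, rfl⟩
  exact hall i

/-- A path in a leafless subgraph that cannot be prolonged at its end closes up to a cycle. -/
lemma IsSeg.exists_end_cycle {H : Set E} (hH : NoLeafIn D H) {f : ℕ → V} {g : ℕ → E} {k : ℕ}
    (hS : IsSeg D f g k) (hk : 1 ≤ k) (hg : ∀ i < k, g i ∈ H)
    (hmax : ∀ e ∈ H, ∀ t, D.Joins e (f k) t → ∃ j ≤ k, t = f j) :
    ∃ j, j + 2 ≤ k ∧ ∃ C : CycleIn D, Set.range C.vert = f '' Set.Icc j k ∧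
      Set.range C.edge ⊆ H ∧ g '' Set.Ico j k ⊆ Set.range C.edge := by
  have hlast := hS.joins (k - 1) (by omega)
  rw [Nat.sub_add_cancel hk] at hlast
  obtain ⟨e, heH, hne, hinc⟩ := hH _ (hg (k - 1) (by omega)) (f k)
    (hlast.incident_iff.mpr (Or.inr rfl))
  obtain ⟨t, ht⟩ := exists_joins_of_incident hinc
  obtain ⟨j, hjk, rfl⟩ := hmax e heH t ht
  have hj1 : j ≠ k := fun h => ht.ne (h ▸ rfl)
  have hj2 : j ≠ k - 1 := fun h => hne (ht.edge_eq (h ▸ hlast.symm))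
  refine ⟨j, by omega, ?_⟩
  have hA := hS.sub j (k - j) (by omega)
  have hB : IsSeg D (fun i => if i = 0 then f k else f j) (fun _ => e) 1 :=
    ⟨fun i hi => by
      obtain rfl : i = 0 := by omega
      simpa using ht,
    fun i hi l hl he => by
      by_contra hil
      have : (i = 0 ∧ l = 1) ∨ (i = 1 ∧ l = 0) := by omega
      rcases this with ⟨rfl, rfl⟩ | ⟨rfl, rfl⟩
      · exact ht.ne (by simpa using he)
      · exact ht.ne (by simpa using he.symm)⟩
  obtain ⟨C, hv, he⟩ := hA.exists_cycle hB (by omega) le_rfl (by omega)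
    (by simp [Nat.add_sub_cancel' hjk]) (by simp) (by
      intro i hi0 hik l hl heq
      by_cases hl0 : l = 0
      · rw [if_pos hl0] at heq
        have := hS.inj (j + i) (by omega) k le_rfl heq
        omega
      · rw [if_neg hl0] at heq
        have := hS.inj (j + i) (by omega) j (by omega) heq
        omega)
  refine ⟨C, ?_, ?_, ?_⟩
  · rw [hv]
    ext x
    constructor
    · rintro (⟨i, hi, rfl⟩ | ⟨i, hi, rfl⟩)
      · simp only [Set.mem_Iic] at hi
        exact ⟨j + i, ⟨by omega, by omega⟩, rfl⟩
      · by_cases hi0 : i = 0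
        · exact ⟨k, ⟨hjk, le_rfl⟩, by simp [hi0]⟩
        · exact ⟨j, ⟨le_rfl, hjk⟩, by simp [hi0]⟩
    · rintro ⟨i, ⟨hi1, hi2⟩, rfl⟩
      refine Or.inl ⟨i - j, ?_, congrArg f (by omega)⟩
      simp only [Set.mem_Iic]
      omega
  · rw [he]
    rintro _ (⟨i, hi, rfl⟩ | ⟨i, hi, rfl⟩)
    · simp only [Set.mem_Iio] at hi
      exact hg _ (by omega)
    · exact heH
  · rw [he]
    rintro _ ⟨i, ⟨hi1, hi2⟩, rfl⟩
    refine Or.inl ⟨i - j, ?_, congrArg g (by omega)⟩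
    simp only [Set.mem_Iio]
    omega

lemma IsSeg.extend {f : ℕ → V} {g : ℕ → E} {k : ℕ} (hS : IsSeg D f g k) {e : E} {t : V}
    (ht : D.Joins e (f k) t) (hnew : ∀ j ≤ k, t ≠ f j) :
    IsSeg D (fun i => if i ≤ k then f i else t) (fun i => if i < k then g i else e) (k + 1) where
  joins i hi := by
    rcases Nat.lt_or_ge i k with h | h
    · simpa [h, h.le, Nat.succ_le_iff] using hS.joins i h
    · obtain rfl : i = k := by omega
      simpa using ht
  inj i hi j hj he := by
    by_cases h1 : i ≤ k <;> by_cases h2 : j ≤ k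
    · simp only [h1, h2, if_true] at he
      exact hS.inj i h1 j h2 he
    · simp only [h1, h2, if_true, if_false] at he
      exact absurd he.symm (hnew i h1)
    · simp only [h1, h2, if_true, if_false] at he
      exact absurd he (hnew j h2)
    · omega

lemma IsSeg.le_card [Fintype V] {f : ℕ → V} {g : ℕ → E} {k : ℕ} (hS : IsSeg D f g k) :
    k + 1 ≤ Fintype.card V := by
  have h := Fintype.card_le_of_injective (fun i : Fin (k + 1) => f i) fun i j hij =>
    Fin.ext (hS.inj i (by omega) j (by omega) hij)
  simpa using h

/-- In a leafless subgraph, an edge lying on no cycle lies on a path connecting two disjoint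
cycles. -/
lemma exists_connectedByPath [Fintype V] {H : Set E} (hH : NoLeafIn D H) {e : E} (he : e ∈ H)
    (hcyc : ∀ C : CycleIn D, Set.range C.edge ⊆ H → e ∉ Set.range C.edge) :
    ∃ (C₁ C₂ : CycleIn D) (P : PathIn D), Set.range C₁.edge ⊆ H ∧ Set.range C₂.edge ⊆ H ∧
      ConnectedByPath C₁ C₂ P ∧ e ∈ Set.range P.edge := by
  classical
  let Q : ℕ → Prop := fun k => ∃ f g, IsSeg D f g k ∧ (∀ i < k, g i ∈ H) ∧ ∃ i < k, g i = e
  have hQ1 : Q 1 := by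
    refine ⟨fun i => if i = 0 then D.src e else D.tgt e, fun _ => e, ⟨fun i hi => ?_, ?_⟩,
      fun _ _ => he, 0, one_pos, rfl⟩
    · obtain rfl : i = 0 := by omega
      simp [Joins]
    · intro i hi l hl heq
      by_contra hil
      have : (i = 0 ∧ l = 1) ∨ (i = 1 ∧ l = 0) := by omega
      rcases this with ⟨rfl, rfl⟩ | ⟨rfl, rfl⟩
      · exact D.no_loop e (by simpa using heq)
      · exact D.no_loop e (by simpa using heq.symm)
  have hbound : ∀ k, Q k → k ≤ Fintype.card V := by
    rintro k ⟨f, g, hS, -⟩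
    have := hS.le_card
    omega
  set k := Nat.findGreatest Q (Fintype.card V) with hkdef
  have hk1 : 1 ≤ k := Nat.le_findGreatest (hbound 1 hQ1) hQ1
  have hQk : Q k := Nat.findGreatest_spec (hbound 1 hQ1) hQ1
  have hmaxQ : ¬ Q (k + 1) := fun h => by
    have := Nat.le_findGreatest (hbound _ h) h
    omega
  have hend : ∀ f g, IsSeg D f g k → (∀ i < k, g i ∈ H) → (∃ i < k, g i = e) →
      ∀ e' ∈ H, ∀ t, D.Joins e' (f k) t → ∃ j ≤ k, t = f j := by
    rintro f g hS hg ⟨i, hik, hi⟩ e' he' t ht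
    by_contra! hnew
    refine hmaxQ ⟨_, _, hS.extend ht hnew, fun j hj => ?_, i, by omega, by simp [hik, hi]⟩
    by_cases h : j < k
    · simpa [h] using hg j h
    · simpa [h] using he'
  obtain ⟨f, g, hS, hg, i, hik, hi⟩ := hQk
  obtain ⟨m, hmk, C₂, hv2, hH2, hg2⟩ :=
    hS.exists_end_cycle hH hk1 hg (hend f g hS hg ⟨i, hik, hi⟩)
  have hg' : ∀ j < k, g (k - 1 - j) ∈ H := fun j hj => hg _ (by omega)
  obtain ⟨l', hlk, C₁, hv1, hH1, hg1⟩ := hS.reverse.exists_end_cycle hH hk1 hg'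
    (hend _ _ hS.reverse hg' ⟨k - 1 - i, by omega, by
      rw [show k - 1 - (k - 1 - i) = i by omega, hi]⟩)
  set l := k - l' with hl
  have hv1' : ∀ j ≤ k, f j ∈ Set.range C₁.vert → j ≤ l := by
    intro j hj hmem
    rw [hv1] at hmem
    obtain ⟨x, ⟨hx1, hx2⟩, hx⟩ := hmem
    have := hS.inj _ (by omega) _ hj hx
    omega
  have hv2' : ∀ j ≤ k, f j ∈ Set.range C₂.vert → m ≤ j := by
    intro j hj hmem
    rw [hv2] at hmem
    obtain ⟨x, ⟨hx1, hx2⟩, hx⟩ := hmem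
    have := hS.inj _ (by omega) _ hj hx
    omega
  have him : i < m := by
    by_contra h
    exact hcyc C₂ hH2 (hi ▸ hg2 ⟨i, ⟨by omega, hik⟩, rfl⟩)
  have hli : l ≤ i := by
    by_contra h
    refine hcyc C₁ hH1 (hi ▸ hg1 ⟨k - 1 - i, ⟨by omega, by omega⟩, ?_⟩)
    exact congrArg g (by omega)
  have hP := hS.sub l (m - l) (by omega)
  refine ⟨C₁, C₂, hP.toPathIn (by omega), hH1, hH2, ⟨?_, ?_, ?_, ?_, ?_, ?_⟩, ?_⟩
  · rw [Set.eq_empty_iff_forall_notMem]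
    rintro x ⟨hx1, hx2⟩
    rw [hv1] at hx1
    obtain ⟨j, ⟨hj1, hj2⟩, rfl⟩ := hx1
    have := hv2' _ (by omega) hx2
    omega
  · rw [hv1]
    exact ⟨l', ⟨le_rfl, by omega⟩, rfl⟩
  · rw [hv2]
    exact ⟨m, ⟨le_rfl, by omega⟩, congrArg f (show m = l + (m - l) by omega)⟩
  · rintro ⟨j, hj⟩ hj0 hmem
    change j < m - l + 1 at hj
    have := hv1' (l + j) (by omega) hmem
    exact hj0 (Fin.ext (show j = 0 by omega))
  · rintro ⟨j, hj⟩ hj0 hmem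
    change j < m - l + 1 at hj
    have := hv2' (l + j) (by omega) hmem
    exact hj0 (Fin.ext (show j = m - l by omega))
  · rw [hP.range_toPathIn_edge, Set.eq_empty_iff_forall_notMem]
    rintro _ ⟨⟨j, hj, rfl⟩, hC⟩
    simp only [Set.mem_Iio] at hj
    have hjoin := hS.joins (l + j) (by omega)
    rcases hC with hC | hC
    · have := hv1' _ (by omega) (C₁.mem_range_vert hC hjoin).2
      omega
    · have := hv2' _ (by omega) (C₂.mem_range_vert hC hjoin).1
      omega
  · rw [hP.range_toPathIn_edge]
    refine ⟨i - l, ?_, ?_⟩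
    · simp only [Set.mem_Iio]
      omega
    · rw [← hi]
      exact congrArg g (by omega)

end Cycles

end WOGraph

namespace WOGraph

section Supports

variable {V E : Type*} {D : WOGraph V E}

lemma CycleIn.edge_nonempty (C : CycleIn D) : (Set.range C.edge).Nonempty :=
  ⟨_, ⟨0, by have := C.hn; omega⟩, rfl⟩

lemma SharePath.inter_nonempty {C Z : CycleIn D} {P : PathIn D} (h : SharePath C Z P) :
    (Set.range C.edge ∩ Set.range Z.edge).Nonempty := by
  rw [h.2.2.1]
  exact ⟨_, ⟨0, P.hk⟩, rfl⟩

lemma CycleIn.exists_mem_not_mem (C Z : CycleIn D)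
    (hne : Set.range C.edge ≠ Set.range Z.edge) :
    ∃ e ∈ Set.range Z.edge, e ∉ Set.range C.edge := by
  by_contra! h
  exact hne (C.eq_of_noLeafIn Z.noLeafIn Z.edge_nonempty h).symm

variable [DecidableEq V]

lemma inc_ne_zero {v : V} {e : E} (h : D.incident v e) : D.inc v e ≠ 0 := by
  have := D.wpos v
  unfold inc
  split_ifs with h1 h2
  · exact one_ne_zero
  · exact_mod_cast this.ne'
  · exact (h.elim h1 h2).elim

lemma inc_eq_zero {v : V} {e : E} (h : ¬ D.incident v e) : D.inc v e = 0 := by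
  rw [incident, not_or] at h
  rw [inc, if_neg h.1, if_neg h.2]

/-- The support of a vector in the kernel of the incidence matrix is leafless. -/
lemma noLeafIn_vsupp [Fintype E] {b : E → ℤ} (hb : b ∈ D.lattice) : NoLeafIn D (vsupp b) := by
  classical
  intro e he v hv
  by_contra! h
  have hsum := D.mem_lattice.mp hb v
  rw [Finset.sum_eq_single e] at hsum
  · exact mul_ne_zero (inc_ne_zero hv) he hsum
  · intro e' _ hne
    by_cases hb' : b e' = 0
    · rw [hb', mul_zero]
    · rw [inc_eq_zero (h e' hb' hne), zero_mul]
  · exact fun h' => absurd (Finset.mem_univ e) h'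

/-- A cycle is balanced exactly when the kernel of the incidence matrix contains a nonzero
vector supported in it. -/
lemma CycleIn.isBalanced_iff [Fintype E] (C : CycleIn D) :
    C.IsBalanced ↔ ∃ b ∈ D.lattice, b ≠ 0 ∧ vsupp b ⊆ Set.range C.edge := by
  classical
  have key : ∀ b : E → ℤ, vsupp b ⊆ Set.range C.edge → ∀ v,
      ∑ e, D.inc v e * b e = ∑ j, D.inc v (C.edge j) * b (C.edge j) := by
    intro b hb v
    refine (Finset.sum_of_injOn C.edge C.einj.injOn (by simp) ?_ (fun _ _ => rfl)).symm
    intro e _ he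
    have : e ∉ vsupp b := fun h => he (by simpa using hb h)
    rw [not_not.mp (show ¬ b e ≠ 0 from this), mul_zero]
  rw [IsBalanced, ← Matrix.exists_mulVec_eq_zero_iff]
  constructor
  · rintro ⟨x, hx0, hx⟩
    have hext : ∀ j, Function.extend C.edge x (fun _ => 0) (C.edge j) = x j :=
      fun j => C.einj.extend_apply x _ j
    have hsub : vsupp (Function.extend C.edge x (fun _ => 0)) ⊆ Set.range C.edge := by
      intro e he
      by_contra hne
      exact he (Function.extend_apply' x _ e hne)
    refine ⟨Function.extend C.edge x (fun _ => 0), D.mem_lattice.mpr fun v => ?_,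
      fun h => hx0 ?_, hsub⟩
    · rw [key _ hsub]
      by_cases hv : v ∈ Set.range C.vert
      · obtain ⟨i, rfl⟩ := hv
        simp only [hext]
        exact congrFun hx i
      · refine Finset.sum_eq_zero fun j _ => ?_
        rw [inc_eq_zero, zero_mul]
        intro hinc
        obtain ⟨u, hu⟩ := exists_joins_of_incident hinc
        exact hv (C.mem_range_vert ⟨j, rfl⟩ hu).1
    · ext j
      rw [← hext, h]
      rfl
  · rintro ⟨b, hb, hb0, hsub⟩
    refine ⟨fun j => b (C.edge j), fun h => ?_, ?_⟩
    · obtain ⟨e, he⟩ := vsupp_nonempty hb0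
      obtain ⟨j, rfl⟩ := hsub he
      exact he (congrFun h j)
    · ext i
      have := D.mem_lattice.mp hb (C.vert i)
      rw [key _ hsub] at this
      exact this

lemma CycleIn.vsupp_eq_of_subset [Fintype E] (C : CycleIn D) {b : E → ℤ} (hb : b ∈ D.lattice)
    (hb0 : b ≠ 0) (hsub : vsupp b ⊆ Set.range C.edge) : vsupp b = Set.range C.edge :=
  C.eq_of_noLeafIn (noLeafIn_vsupp hb) (vsupp_nonempty hb0) hsub

lemma CycleIn.IsUnbalanced.not_vsupp_subset [Fintype E] {C : CycleIn D} (hC : C.IsUnbalanced)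
    {b : E → ℤ} (hb : b ∈ D.lattice) (hb0 : b ≠ 0) : ¬ vsupp b ⊆ Set.range C.edge :=
  fun h => hC (C.isBalanced_iff.mpr ⟨b, hb, hb0, h⟩)

/-- Balanced and unbalanced cycles have different edge sets. -/
lemma CycleIn.IsUnbalanced.edge_ne [Fintype E] {C Z : CycleIn D} (hC : C.IsUnbalanced)
    (hZ : Z.IsBalanced) : Set.range C.edge ≠ Set.range Z.edge := by
  obtain ⟨b, hb, hb0, hsub⟩ := Z.isBalanced_iff.mp hZ
  exact fun h => hC.not_vsupp_subset hb hb0 (h ▸ hsub)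

lemma eq_or_eq_or_eq_of_pair {S₁ S₂ A B C : Set E} (hA : A = S₁ ∨ A = S₂) (hB : B = S₁ ∨ B = S₂)
    (hC : C = S₁ ∨ C = S₂) : A = B ∨ A = C ∨ B = C := by
  rcases hA with rfl | rfl <;> rcases hB with rfl | rfl <;> rcases hC with rfl | rfl <;> simp

/-- Two balanced cycles sharing an edge coincide. -/
lemma CycleIn.IsBalanced.edge_eq {S₁ S₂ : Set E}
    (h2 : ∀ C : CycleIn D, C.IsUnbalanced → Set.range C.edge = S₁ ∨ Set.range C.edge = S₂)
    (hii : ∀ C₁ C₂ : CycleIn D, C₁.IsBalanced → C₂.IsBalanced → ∀ P, ¬ SharePath C₁ C₂ P)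
    {B Z : CycleIn D} (hB : B.IsBalanced) (hZ : Z.IsBalanced) {e : E}
    (he : e ∈ Set.range B.edge) (heZ : e ∈ Set.range Z.edge) :
    Set.range B.edge = Set.range Z.edge := by
  by_contra hne
  obtain ⟨e', he', hnB⟩ := B.exists_mem_not_mem Z hne
  obtain ⟨C₁, C₂, ⟨P₁, hP₁⟩, ⟨P₂, hP₂⟩, -, -, -, -, -, h12, h⟩ := B.exists_theta Z he heZ he' hnB
  rcases h with ⟨P, hP⟩ | ⟨C₃, ⟨P₃, hP₃⟩, h31, h32⟩
  · exact hii B Z hB hZ P hP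
  have hu1 : C₁.IsUnbalanced := fun h => hii B C₁ hB h P₁ hP₁
  have hu2 : C₂.IsUnbalanced := fun h => hii B C₂ hB h P₂ hP₂
  have hu3 : C₃.IsUnbalanced := fun h => hii B C₃ hB h P₃ hP₃
  rcases eq_or_eq_or_eq_of_pair (h2 C₁ hu1) (h2 C₂ hu2) (h2 C₃ hu3) with h | h | h
  · exact h12 h
  · exact h31 h.symm
  · exact h32 h.symm

/-- The support of a nonzero kernel vector that contains no balanced cycle contains two
unbalanced cycles. -/
lemma exists_two_cycles_of_mem_lattice [Fintype V] [Fintype E] {b : E → ℤ} (hb : b ∈ D.lattice)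
    (hb0 : b ≠ 0) (hun : ∀ C : CycleIn D, Set.range C.edge ⊆ vsupp b → C.IsUnbalanced) :
    ∃ C₁ C₂ : CycleIn D, Set.range C₁.edge ⊆ vsupp b ∧ Set.range C₂.edge ⊆ vsupp b ∧
      Set.range C₁.edge ≠ Set.range C₂.edge := by
  have hleaf := noLeafIn_vsupp hb
  by_cases hall : ∀ e ∈ vsupp b, ∃ C : CycleIn D, Set.range C.edge ⊆ vsupp b ∧
      e ∈ Set.range C.edge
  · obtain ⟨e, he⟩ := vsupp_nonempty hb0
    obtain ⟨C, hC, -⟩ := hall e he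
    obtain ⟨e', he', hnC⟩ := Set.not_subset.mp ((hun C hC).not_vsupp_subset hb hb0)
    obtain ⟨C', hC', h⟩ := hall e' he'
    exact ⟨C, C', hC, hC', fun heq => hnC (heq ▸ h)⟩
  · push Not at hall
    obtain ⟨e, he, hcyc⟩ := hall
    obtain ⟨C₁, C₂, P, h1, h2, hP, -⟩ := exists_connectedByPath hleaf he hcyc
    refine ⟨C₁, C₂, h1, h2, fun heq => ?_⟩
    obtain ⟨f, ⟨i, hi⟩⟩ := C₁.edge_nonempty
    have hf2 : f ∈ Set.range C₂.edge := heq ▸ ⟨i, hi⟩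
    have h₁ := (C₁.mem_range_vert ⟨i, hi⟩ (u := D.src f) (v := D.tgt f) rfl).1
    have h₂ := (C₂.mem_range_vert hf2 (u := D.src f) (v := D.tgt f) rfl).1
    exact Set.notMem_empty _ (hP.1.le ⟨h₁, h₂⟩)

lemma pair_subset_vsupp [Fintype V] [Fintype E] {S₁ S₂ : Set E}
    (h2 : ∀ C : CycleIn D, C.IsUnbalanced → Set.range C.edge = S₁ ∨ Set.range C.edge = S₂)
    {b : E → ℤ} (hb : b ∈ D.lattice) (hb0 : b ≠ 0)
    (hun : ∀ C : CycleIn D, Set.range C.edge ⊆ vsupp b → C.IsUnbalanced) :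
    S₁.Nonempty ∧ S₁ ⊆ vsupp b ∧ S₂ ⊆ vsupp b := by
  obtain ⟨C₁, C₂, hs1, hs2, hne⟩ := exists_two_cycles_of_mem_lattice hb hb0 hun
  have n1 := C₁.edge_nonempty
  have n2 := C₂.edge_nonempty
  rcases h2 C₁ (hun C₁ hs1) with h | h <;> rcases h2 C₂ (hun C₂ hs2) with h' | h' <;>
    rw [h] at hs1 hne n1 <;> rw [h'] at hs2 hne n2
  · exact absurd rfl hne
  · exact ⟨n1, hs1, hs2⟩
  · exact ⟨n2, hs2, hs1⟩
  · exact absurd rfl hne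

/-- A balanced cycle is edge-disjoint from every support of a kernel vector that contains no
balanced cycle. -/
lemma CycleIn.IsBalanced.not_mem_vsupp [Fintype V] [Fintype E] {S₁ S₂ : Set E}
    (h2 : ∀ C : CycleIn D, C.IsUnbalanced → Set.range C.edge = S₁ ∨ Set.range C.edge = S₂)
    (hi : ∀ C₁ C₂ : CycleIn D, C₁.IsUnbalanced → C₂.IsUnbalanced →
      ∀ P, ConnectedByPath C₁ C₂ P → ∀ C : CycleIn D, C.IsBalanced →
        Set.range C.edge ∩ Set.range P.edge = ∅)
    (hii : ∀ C₁ C₂ : CycleIn D, C₁.IsBalanced → C₂.IsBalanced → ∀ P, ¬ SharePath C₁ C₂ P)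
    {b : E → ℤ} (hb : b ∈ D.lattice) (hb0 : b ≠ 0)
    (hun : ∀ C : CycleIn D, Set.range C.edge ⊆ vsupp b → C.IsUnbalanced)
    {B : CycleIn D} (hB : B.IsBalanced) {e : E} (he : e ∈ Set.range B.edge) : e ∉ vsupp b := by
  intro heb
  by_cases hex : ∃ C : CycleIn D, Set.range C.edge ⊆ vsupp b ∧ e ∈ Set.range C.edge
  · obtain ⟨-, hS1, hS2⟩ := pair_subset_vsupp h2 hb hb0 hun
    obtain ⟨C, hC, heC⟩ := hex
    have hCu := hun C hC
    obtain ⟨e', he', hnC⟩ := C.exists_mem_not_mem B (hCu.edge_ne hB)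
    obtain ⟨C₁, C₂, ⟨P₁, hP₁⟩, ⟨P₂, hP₂⟩, ⟨P, hP⟩, -, -, hn1, hn2, -⟩ :=
      C.exists_theta B heC he he' hnC
    have hX : ∃ X : CycleIn D, X.IsUnbalanced ∧ Set.range X.edge ≠ Set.range C.edge ∧
        (Set.range C.edge ∩ Set.range X.edge).Nonempty := by
      by_cases hB1 : C₁.IsBalanced
      · exact ⟨C₂, fun hB2 => hii C₁ C₂ hB1 hB2 P hP, hn2, hP₂.inter_nonempty⟩
      · exact ⟨C₁, hB1, hn1, hP₁.inter_nonempty⟩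
    obtain ⟨X, hXu, hXC, f, hfC, hfX⟩ := hX
    have hXs : Set.range X.edge ⊆ vsupp b := by
      rcases h2 X hXu with h | h <;> rw [h] <;> assumption
    obtain ⟨f', hf', hnC⟩ := C.exists_mem_not_mem X hXC.symm
    obtain ⟨Y₁, Y₂, -, -, -, hY1, hY2, hne1, hne2, hne, -⟩ := C.exists_theta X hfC hfX hf' hnC
    have hCX := Set.union_subset hC hXs
    rcases eq_or_eq_or_eq_of_pair (h2 C hCu) (h2 Y₁ (hun _ (hY1.trans hCX)))
      (h2 Y₂ (hun _ (hY2.trans hCX))) with h | h | h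
    · exact hne1 h.symm
    · exact hne2 h.symm
    · exact hne h
  · push Not at hex
    obtain ⟨C₁, C₂, P, hs1, hs2, hP, heP⟩ := exists_connectedByPath (noLeafIn_vsupp hb) heb hex
    exact Set.notMem_empty e ((hi C₁ C₂ (hun _ hs1) (hun _ hs2) P hP B hB).le ⟨he, heP⟩)

/-- A minimal support is either a balanced cycle or contains no balanced cycle. -/
lemma _root_.IsMinSupp.eq_cycle_or [Fintype E] {b : E → ℤ} (hb : IsMinSupp D.lattice b) :
    (∃ B : CycleIn D, B.IsBalanced ∧ vsupp b = Set.range B.edge) ∨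
      ∀ C : CycleIn D, Set.range C.edge ⊆ vsupp b → C.IsUnbalanced := by
  rw [or_iff_not_imp_right]
  intro h
  push Not at h
  obtain ⟨B, hB, hBu⟩ := h
  have hBal : B.IsBalanced := not_not.mp hBu
  obtain ⟨c, hc, hc0, hcs⟩ := B.isBalanced_iff.mp hBal
  refine ⟨B, hBal, ?_⟩
  rw [← B.vsupp_eq_of_subset hc hc0 hcs]
  exact (hb.2.2 c hc hc0 (hcs.trans hB)).symm

/-- Minimal supports of kernel vectors are pairwise equal or disjoint. -/
theorem _root_.IsMinSupp.vsupp_eq_of_mem [Fintype V] [Fintype E] {S₁ S₂ : Set E}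
    (h2 : ∀ C : CycleIn D, C.IsUnbalanced → Set.range C.edge = S₁ ∨ Set.range C.edge = S₂)
    (hi : ∀ C₁ C₂ : CycleIn D, C₁.IsUnbalanced → C₂.IsUnbalanced →
      ∀ P, ConnectedByPath C₁ C₂ P → ∀ C : CycleIn D, C.IsBalanced →
        Set.range C.edge ∩ Set.range P.edge = ∅)
    (hii : ∀ C₁ C₂ : CycleIn D, C₁.IsBalanced → C₂.IsBalanced → ∀ P, ¬ SharePath C₁ C₂ P)
    {b c : E → ℤ} (hb : IsMinSupp D.lattice b) (hc : IsMinSupp D.lattice c) {e : E}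
    (heb : e ∈ vsupp b) (hec : e ∈ vsupp c) : vsupp b = vsupp c := by
  rcases hb.eq_cycle_or with ⟨B, hB, hbB⟩ | hbu <;> rcases hc.eq_cycle_or with ⟨Z, hZ, hcZ⟩ | hcu
  · rw [hbB, hcZ]
    exact hB.edge_eq h2 hii hZ (hbB ▸ heb) (hcZ ▸ hec)
  · exact absurd hec (hB.not_mem_vsupp h2 hi hii hc.1 hc.2.1 hcu (hbB ▸ heb))
  · exact absurd heb (hZ.not_mem_vsupp h2 hi hii hb.1 hb.2.1 hbu (hcZ ▸ hec))
  obtain ⟨⟨s, hs⟩, hSb, -⟩ := pair_subset_vsupp h2 hb.1 hb.2.1 hbu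
  obtain ⟨-, hSc, -⟩ := pair_subset_vsupp h2 hc.1 hc.2.1 hcu
  by_contra hne
  have hd := cross_mem hb.1 hc.1 s
  set d : E → ℤ := fun f => c s * b f - b s * c f with hdef
  obtain ⟨f, hf⟩ : ∃ f, f ∈ vsupp d := by
    by_contra! hall
    refine hne (Set.ext fun f => not_iff_not.mp ?_)
    have hf0 : c s * b f - b s * c f = 0 := not_not.mp (hall f)
    have hbs : b s ≠ 0 := hSb hs
    have hcs : c s ≠ 0 := hSc hs
    simp only [vsupp, Set.mem_ofPred_eq, not_not]
    constructor <;> intro h0 <;> simpa [h0, hbs, hcs] using hf0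
  obtain ⟨a, ha, hfa, had⟩ := exists_isMinSupp_mem hd hf
  rcases ha.eq_cycle_or with ⟨B, hB, haB⟩ | hau
  · have hfB : f ∈ Set.range B.edge := haB ▸ hfa
    have hfb : b f = 0 := not_not.mp (hB.not_mem_vsupp h2 hi hii hb.1 hb.2.1 hbu hfB)
    have hfc : c f = 0 := not_not.mp (hB.not_mem_vsupp h2 hi hii hc.1 hc.2.1 hcu hfB)
    exact hf (by simp [hdef, hfb, hfc])
  · obtain ⟨-, hSa, -⟩ := pair_subset_vsupp h2 ha.1 ha.2.1 hau
    exact had (hSa hs) (by simp [hdef, mul_comm])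

end Supports

end WOGraph

open WOGraph in
/-- Theorem 3.5. If `D` has at most two unbalanced cycles, no
balanced cycle of `D` shares an edge with a path connecting two unbalanced
cycles, and no two balanced cycles of `D` share a path, then `Gr_D = C_D` and
`I_D` is strongly robust: the Graver basis is a minimal generating set of `I_D`
(minimality understood up to the sign of a binomial). -/
theorem stmt3 {V E : Type*} [Fintype V] [Fintype E] [DecidableEq V]
    (K : Type*) [Field K] (D : WOGraph V E)
    (h2 : ∃ S₁ S₂ : Set E, ∀ C : CycleIn D, C.IsUnbalanced →
      Set.range C.edge = S₁ ∨ Set.range C.edge = S₂)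
    (hi : ∀ C₁ C₂ : CycleIn D, C₁.IsUnbalanced → C₂.IsUnbalanced →
      ∀ P : PathIn D, ConnectedByPath C₁ C₂ P →
        ∀ C : CycleIn D, C.IsBalanced →
          Set.range C.edge ∩ Set.range P.edge = ∅)
    (hii : ∀ C₁ C₂ : CycleIn D, C₁.IsBalanced → C₂.IsBalanced →
      ∀ P : PathIn D, ¬ SharePath C₁ C₂ P) :
    D.graverSet K = D.circuitSet K ∧
    Ideal.span (D.graverSet K) = D.toricIdeal K ∧
    ∀ f ∈ D.graverSet K,
      Ideal.span (D.graverSet K \ {f, -f}) ≠ D.toricIdeal K := by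
  obtain ⟨S₁, S₂, h2⟩ := h2
  exact D.graverSet_eq_circuitSet_and_minimal K fun b c hb hc e heb hec =>
    IsMinSupp.vsupp_eq_of_mem h2 hi hii hb hc heb hec
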